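/- arXiv:0905.1737 — 2 statements merged into one kernel-verified Lean document; each statement's English description precedes it below -/
import Mathlib

section
/- For every finite connected simple graph G on n ≥ 2 vertices, there exist a port numbering π of G and a closed RH-walk with respect to π that visits every vertex of G and whose length L satisfies 3L ≤ 13n − 12 (i.e., L ≤ 4⅓·n − 4). -/
/-- The degree of a vertex, as the cardinality of its neighbor set. -/
noncomputable def portDeg {V : Type*} (G : SimpleGraph V) (v : V) : ℕ :=
  (G.neighborSet v).ncard

/-- A port numbering assigns to each vertex `v` a bijection from its neighbors
onto `{1, …, deg v}`. -/
def IsPortNumbering {V : Type*} (G : SimpleGraph V) (π : V → V → ℕ) : Prop :=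
  ∀ v : V, Set.BijOn (π v) (G.neighborSet v) (Set.Icc 1 (portDeg G v))

/-- A closed right-hand walk of length `L ≥ 1` with respect to the port numbering `π`:
an `L`-periodic sequence of vertices, consecutive ones adjacent, such that the exit
port is always the cyclic successor of the entry port. -/
def IsClosedRHWalk {V : Type*} (G : SimpleGraph V) (π : V → V → ℕ) (L : ℕ) (w : ℕ → V) : Prop :=
  1 ≤ L ∧ (∀ i, w (i + L) = w i) ∧ (∀ i, G.Adj (w i) (w (i + 1))) ∧
    (∀ i, π (w (i + 1)) (w (i + 2)) = π (w (i + 1)) (w i) % portDeg G (w (i + 1)) + 1)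

/-- The walk visits every vertex within one period. -/
def VisitsAll {V : Type*} (L : ℕ) (w : ℕ → V) : Prop :=
  ∀ v : V, ∃ i < L, w i = v

open Equiv Function

section Rotation

variable {α : Type*}

/-- Numbering the elements of a cyclically permuted set along the cycle. -/
theorem exists_numbering_of_isCycleOn (f : Perm α) (s : Set α) (hs : s.Finite)
    (hf : f.IsCycleOn s) :
    ∃ π : α → ℕ, Set.BijOn π s (Set.Icc 1 s.ncard) ∧ ∀ x ∈ s, π (f x) = π x % s.ncard + 1 := by
  rcases s.eq_empty_or_nonempty with rfl | ⟨b, hb⟩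
  · exact ⟨fun _ => 0, by simp⟩
  lift s to Finset α using hs
  rw [Set.ncard_coe_finset]
  have hb' : b ∈ s := hb
  have hpos : 0 < s.card := Finset.card_pos.2 ⟨b, hb'⟩
  have bij : Set.BijOn (fun k : ℕ => (f ^ k) b) (Set.Icc 1 s.card) s := by
    refine ⟨fun k _ => ?_, fun i hi j hj hij => ?_, fun x hx => ?_⟩
    · exact (hf.1.perm_pow k).mapsTo hb
    · have := (hf.pow_apply_eq_pow_apply hb').1 hij
      rcases hi with ⟨hi1, hi2⟩
      rcases hj with ⟨hj1, hj2⟩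
      rcases Nat.lt_or_ge i s.card with h | h
      · rcases Nat.lt_or_ge j s.card with h' | h'
        · exact Nat.ModEq.eq_of_lt_of_lt this h h'
        · have h3 : j = s.card := le_antisymm hj2 h'
          rw [h3, Nat.ModEq, Nat.mod_self, Nat.mod_eq_of_lt h] at this
          omega
      · have h3 : i = s.card := le_antisymm hi2 h
        rcases Nat.lt_or_ge j s.card with h' | h'
        · rw [h3, Nat.ModEq, Nat.mod_self, Nat.mod_eq_of_lt h'] at this
          omega
        · omega
    · obtain ⟨n, hn, rfl⟩ := hf.exists_pow_eq hb' hx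
      rcases Nat.eq_zero_or_pos n with rfl | h0
      · exact ⟨s.card, ⟨hpos, le_rfl⟩, by simpa using hf.pow_card_apply hb'⟩
      · exact ⟨n, ⟨h0, hn.le⟩, rfl⟩
  set π := Function.invFunOn (fun k : ℕ => (f ^ k) b) (Set.Icc 1 s.card) with hπ
  have inv : Set.InvOn π (fun k : ℕ => (f ^ k) b) (Set.Icc 1 s.card) s := bij.invOn_invFunOn
  have bij' : Set.BijOn π s (Set.Icc 1 s.card) := (Set.bijOn_comm inv.symm).1 bij
  refine ⟨π, bij', fun x hx => ?_⟩
  have hx' := bij'.mapsTo hx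
  have e : f x = (f ^ (π x % s.card + 1)) b := by
    conv_lhs => rw [← inv.2 hx]
    have : (f ^ (π x)) b = (f ^ (π x % s.card)) b :=
      (hf.pow_apply_eq_pow_apply hb').2 (Nat.mod_modEq _ _).symm
    simp only [pow_succ', Perm.mul_apply, this]
  rw [e]
  exact inv.1 ⟨by omega, Nat.mod_lt _ hpos⟩

variable [DecidableEq α]

/-- The permutation `f` with `v` taken out of its place behind `p` and put behind `a`,
when `f p = v`. -/
def moveBehind (f : Perm α) (a p v : α) : Perm α := f * (swap a p * swap p v)

variable {f : Perm α} {a p v : α}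

theorem moveBehind_left (hap : a ≠ p) (hav : a ≠ v) : moveBehind f a p v a = f p := by
  simp [moveBehind, swap_apply_of_ne_of_ne hap hav]

theorem moveBehind_middle (hav : a ≠ v) (hpv : p ≠ v) : moveBehind f a p v p = f v := by
  simp [moveBehind, swap_apply_of_ne_of_ne hav.symm hpv.symm]

theorem moveBehind_right : moveBehind f a p v v = f a := by
  simp [moveBehind]

theorem moveBehind_of_ne {x : α} (ha : x ≠ a) (hp : x ≠ p) (hv : x ≠ v) :
    moveBehind f a p v x = f x := by
  simp [moveBehind, swap_apply_of_ne_of_ne hp hv, swap_apply_of_ne_of_ne ha hp]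

theorem isCycleOn_moveBehind {s : Set α} (hs : s.Finite) (hf : f.IsCycleOn s) (ha : a ∈ s)
    (hp : p ∈ s) (hav : a ≠ v) (hap : a ≠ p) (hpv : p ≠ v) (hfp : f p = v) :
    (moveBehind f a p v).IsCycleOn s := by
  have hv : v ∈ s := hfp ▸ hf.1.mapsTo hp
  set g := moveBehind f a p v with hg
  have ga : g a = v := by rw [hg, moveBehind_left hap hav, hfp]
  have gp : g p = f v := moveBehind_middle hav hpv
  have gv : g v = f a := moveBehind_right
  have gx : ∀ x, x ≠ a → x ≠ p → x ≠ v → g x = f x := fun x => moveBehind_of_ne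
  have hvp : g.SameCycle v p := by
    obtain ⟨n, hn⟩ := hf.exists_pow_eq' hs hv ha
    have hex : ∃ n : ℕ, (f ^ n) v = a := ⟨n, hn⟩
    classical
    set k := Nat.find hex with hk
    have hka : (f ^ k) v = a := Nat.find_spec hex
    have hkpos : 0 < k := by
      rcases Nat.eq_zero_or_pos k with h | h
      · rw [h] at hka
        exact absurd hka.symm hav
      · exact h
    have key : ∀ i, i < k → g.SameCycle p ((f ^ (i + 1)) v) := by
      intro i
      induction i with
      | zero =>
        intro _
        rw [zero_add, pow_one, ← gp]
        exact Perm.sameCycle_apply_right.2 (.refl _ _)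
      | succ i ih =>
        intro hi
        have h1 := ih (by omega)
        have e : (f ^ (i + 1 + 1)) v = f ((f ^ (i + 1)) v) := by rw [pow_succ']; rfl
        have hback : ∀ j, 0 < j → j ≤ k → (f ^ j) v ≠ v := by
          intro j hj hjk hjv
          have : (f ^ (k - j)) v = a := by
            rw [← hka]
            conv_lhs => rw [← hjv]
            rw [← Perm.mul_apply, ← pow_add, Nat.sub_add_cancel hjk]
          have := Nat.find_min' hex this
          omega
        have n1 : (f ^ (i + 1)) v ≠ a := fun h => by
          have := Nat.find_min' hex h
          omega
        have n2 : (f ^ (i + 1)) v ≠ p := fun h => by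
          apply hback (i + 1 + 1) (by omega) (by omega)
          rw [e, h, hfp]
        have n3 := hback (i + 1) (by omega) (by omega)
        rw [e, ← gx _ n1 n2 n3]
        exact Perm.sameCycle_apply_right.2 h1
    have h2 := key (k - 1) (by omega)
    rw [Nat.sub_add_cancel hkpos, hka] at h2
    have h3 : g.SameCycle a v := by rw [← ga]; exact Perm.sameCycle_apply_right.2 (.refl _ _)
    exact (h2.trans h3).symm
  have hav' : g.SameCycle a v := by rw [← ga]; exact Perm.sameCycle_apply_right.2 (.refl _ _)
  have step : ∀ x, g.SameCycle x (f x) := by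
    intro x
    by_cases h1 : x = a
    · subst h1
      rw [← gv]
      exact Perm.sameCycle_apply_right.2 hav'
    by_cases h2 : x = p
    · subst h2
      rw [hfp]
      exact hvp.symm
    by_cases h3 : x = v
    · subst h3
      rw [← gp]
      exact Perm.sameCycle_apply_right.2 hvp
    rw [← gx x h1 h2 h3]
    exact Perm.sameCycle_apply_right.2 (.refl _ _)
  have hmem : ∀ x ∈ s, g x ∈ s := by
    intro x hx
    by_cases h1 : x = a
    · rw [h1, ga]; exact hv
    by_cases h2 : x = p
    · rw [h2, gp]; exact hf.1.mapsTo hv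
    by_cases h3 : x = v
    · rw [h3, gv]; exact hf.1.mapsTo ha
    rw [gx x h1 h2 h3]; exact hf.1.mapsTo hx
  refine ⟨?_, ?_⟩
  · refine ⟨hmem, g.injective.injOn, fun y hy => ?_⟩
    obtain ⟨x, hx, e⟩ := Set.surj_on_of_inj_on_of_ncard_le (fun x _ => g x) hmem
      (fun _ _ _ _ h => g.injective h) le_rfl hs y hy
    exact ⟨x, hx, e.symm⟩
  · intro x hx y hy
    obtain ⟨n, rfl⟩ := hf.exists_pow_eq' hs hx hy
    clear hy
    induction n with
    | zero => exact .refl _ _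
    | succ n ih =>
      rw [pow_succ', Perm.mul_apply]
      exact ih.trans (step _)

end Rotation

section ArcPerm

variable {V : Type*}

/-- The permutation of arcs that sends the arc `(u, v)` to the arc leaving `v` towards the
successor of `u` in the rotation at `v`. -/
def arcPerm (ρ : V → Perm V) : Perm (V × V) where
  toFun e := (e.2, ρ e.2 e.1)
  invFun e := ((ρ e.1).symm e.2, e.1)
  left_inv e := by simp
  right_inv e := by simp

@[simp] theorem arcPerm_apply (ρ : V → Perm V) (e : V × V) : arcPerm ρ e = (e.2, ρ e.2 e.1) := rfl

/-- The system `ρ` of rotations of the sets `N v` maps the arcs of `A` entering a vertex onto the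
arcs of `A` leaving it. -/
structure IsRotationSystem (N : V → Set V) (A : V → V → Prop) (ρ : V → Perm V) : Prop where
  isCycleOn : ∀ v, (ρ v).IsCycleOn (N v)
  arc_iff : ∀ u v, A u v ↔ A v (ρ v u)

variable {N : V → Set V} {A : V → V → Prop} {ρ : V → Perm V}

theorem IsRotationSystem.arc_iterate (hρ : IsRotationSystem N A ρ) {e : V × V} (he : A e.1 e.2)
    (i : ℕ) : A ((arcPerm ρ)^[i] e).1 ((arcPerm ρ)^[i] e).2 := by
  induction i with
  | zero => exact he
  | succ i ih => rw [iterate_succ_apply']; exact (hρ.arc_iff _ _).1 ih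

variable [Finite V]

theorem arcPerm_mem_periodicPts (e : V × V) : e ∈ periodicPts (arcPerm ρ) :=
  (arcPerm ρ).injective.mem_periodicPts e

variable [DecidableEq V]

theorem IsRotationSystem.exists_minimalPeriod_lt (hρ : IsRotationSystem N A ρ)
    (hAN : ∀ u v, A u v → u ∈ N v) {x u v : V} (hx : A x u) (huv : A u v) (hvu : A v u)
    (hv : ∀ j, ((arcPerm ρ)^[j] (x, u)).2 ≠ v) :
    ∃ ρ', IsRotationSystem N A ρ' ∧
      minimalPeriod (arcPerm ρ) (x, u) < minimalPeriod (arcPerm ρ') (v, u) := by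
  set φ := arcPerm ρ with hφ
  set L := minimalPeriod φ (x, u) with hL
  have hLpos : 0 < L := minimalPeriod_pos_of_mem_periodicPts (arcPerm_mem_periodicPts _)
  obtain ⟨p, hp⟩ : ∃ p, ρ u p = v := ⟨(ρ u).symm v, by simp⟩
  have nv : ∀ j, φ^[j] (x, u) ≠ (v, u) := by
    have h : ∀ j, φ^[j + 1] (x, u) ≠ (v, u) := fun j e => hv j <| by
      rw [iterate_succ_apply'] at e
      exact congrArg Prod.fst e
    rintro (_ | j)
    · obtain ⟨k, hk⟩ : ∃ k, L = k + 1 := ⟨L - 1, by omega⟩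
      have := h k
      rwa [← hk, hL, iterate_minimalPeriod] at this
    · exact h j
  have np : ∀ j, φ^[j] (x, u) ≠ (p, u) := fun j e => hv (j + 1) <| by
    rw [iterate_succ_apply', e, hφ, arcPerm_apply]
    exact hp
  have hxv : x ≠ v := fun h => nv 0 (by rw [h]; rfl)
  have hxp : x ≠ p := fun h => np 0 (by rw [h]; rfl)
  have hpv : p ≠ v := by
    rintro rfl
    obtain ⟨k, hk⟩ := (hρ.isCycleOn u).2 (hAN _ _ hvu) (hAN _ _ hx)
    rw [Perm.zpow_apply_eq_self_of_apply_eq_self hp] at hk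
    exact hxp hk.symm
  have hpu : A p u := by rw [hρ.arc_iff, hp]; exact huv
  refine ⟨update ρ u (moveBehind (ρ u) x p v), ⟨fun w => ?_, fun z w => ?_⟩, ?_⟩
  · rcases eq_or_ne w u with rfl | hw
    · rw [update_self]
      exact isCycleOn_moveBehind (Set.toFinite _) (hρ.isCycleOn w) (hAN _ _ hx) (hAN _ _ hpu)
        hxv hxp hpv hp
    · rw [update_of_ne hw]
      exact hρ.isCycleOn w
  · rcases eq_or_ne w u with rfl | hw
    · rw [update_self]
      by_cases h1 : z = x
      · rw [h1, moveBehind_left hxp hxv, hp]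
        exact iff_of_true hx huv
      by_cases h2 : z = p
      · rw [h2, moveBehind_middle hxv hpv, ← hρ.arc_iff]
        exact iff_of_true hpu hvu
      by_cases h3 : z = v
      · rw [h3, moveBehind_right, ← hρ.arc_iff]
        exact iff_of_true hvu hx
      rw [moveBehind_of_ne h1 h2 h3]
      exact hρ.arc_iff z w
    · rw [update_of_ne hw]
      exact hρ.arc_iff z w
  · set φ' := arcPerm (update ρ u (moveBehind (ρ u) x p v)) with hφ'
    have key : ∀ j < L, φ'^[j + 1] (v, u) = φ^[j + 1] (x, u) := by
      intro j
      induction j with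
      | zero =>
        intro _
        simp [hφ, hφ', moveBehind_right]
      | succ j ih =>
        intro hj
        rw [iterate_succ_apply', ih (by omega), iterate_succ_apply' _ (j + 1)]
        have h1 : φ^[j + 1] (x, u) ≠ (x, u) := fun h =>
          not_isPeriodicPt_of_pos_of_lt_minimalPeriod (by omega) hj h
        have h2 := np (j + 1)
        have h3 := nv (j + 1)
        generalize φ^[j + 1] (x, u) = e at h1 h2 h3
        obtain ⟨z, w⟩ := e
        rcases eq_or_ne w u with rfl | hw
        · simp only [hφ, hφ', arcPerm_apply, update_self]
          rw [moveBehind_of_ne (by simpa using h1) (by simpa using h2) (by simpa using h3)]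
        · simp only [hφ, hφ', arcPerm_apply, update_of_ne hw]
    by_contra! hle
    have hpos : 0 < minimalPeriod φ' (v, u) :=
      minimalPeriod_pos_of_mem_periodicPts (arcPerm_mem_periodicPts _)
    obtain ⟨k, hk⟩ : ∃ k, minimalPeriod φ' (v, u) = k + 1 :=
      ⟨minimalPeriod φ' (v, u) - 1, by omega⟩
    apply nv (k + 1)
    rw [← key k (by omega), ← hk, iterate_minimalPeriod]

/-- Rotations that preserve a set of arcs containing both orientations of all edges of a connected
graph can be changed so that a single orbit of arcs visits all vertices. -/
theorem IsRotationSystem.exists_forall_mem_orbit (hρ : IsRotationSystem N A ρ)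
    (hAN : ∀ u v, A u v → u ∈ N v) {D : SimpleGraph V} (hD : D.Connected)
    (hDA : ∀ u v, D.Adj u v → A u v) {e : V × V} (he : A e.1 e.2) :
    ∃ ρ' e', IsRotationSystem N A ρ' ∧ A e'.1 e'.2 ∧ ∀ v, ∃ i, ((arcPerm ρ')^[i] e').2 = v := by
  obtain ⟨⟨⟨ρ', e'⟩, hρ', he'⟩, hmax⟩ :=
    have : Nonempty {q : (V → Perm V) × (V × V) // IsRotationSystem N A q.1 ∧ A q.2.1 q.2.2} :=
      ⟨⟨(ρ, e), hρ, he⟩⟩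
    Finite.exists_max fun q : {q : (V → Perm V) × (V × V) //
      IsRotationSystem N A q.1 ∧ A q.2.1 q.2.2} => minimalPeriod (arcPerm q.1.1) q.1.2
  dsimp only at hρ' he' hmax
  refine ⟨ρ', e', hρ', he', fun v => ?_⟩
  obtain ⟨W⟩ := hD e'.2 v
  suffices ∀ {a b} (W : D.Walk a b), (∃ i, ((arcPerm ρ')^[i] e').2 = a) →
      ∃ i, ((arcPerm ρ')^[i] e').2 = b from this W ⟨0, rfl⟩
  intro a b W
  induction W with
  | nil => exact id
  | @cons a c b hac W ih =>
    rintro ⟨i, hi⟩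
    apply ih
    by_contra! hc
    have ha := hρ'.arc_iterate he' i
    rcases h : (arcPerm ρ')^[i] e' with ⟨x, u⟩
    rw [h] at hi ha
    change A x u at ha
    change u = a at hi
    subst hi
    obtain ⟨ρ'', h1, h2⟩ := hρ'.exists_minimalPeriod_lt hAN ha (hDA _ _ hac) (hDA _ _ hac.symm)
      (fun j => by rw [← h, ← iterate_add_apply]; exact hc _)
    have := hmax ⟨(ρ'', (c, u)), h1, hDA _ _ hac.symm⟩
    rw [← h, minimalPeriod_apply_iterate (arcPerm_mem_periodicPts _)] at h2
    exact absurd h2 (not_lt.2 this)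

end ArcPerm

section LocalRotation

variable {α : Type*} [DecidableEq α]

theorem exists_list_isChain_mem_iff (N I O : Finset α) (hI : I ⊆ N) (hO : O ⊆ N)
    (hcard : I.card = O.card) (hne : I ≠ O) :
    ∃ (a : α) (l : List α), (a :: l).Nodup ∧ (a :: l).toFinset = N ∧ a ∈ I ∧ a ∉ O ∧
      (a :: l).getLast (List.cons_ne_nil a l) ∉ I ∧
      (a :: l).IsChain (fun x y => x ∈ I ↔ y ∈ O) := by
  induction hk : N.card using Nat.strong_induction_on generalizing N I O with
  | _ k ih =>
  subst hk
  by_cases h1 : ∃ d ∈ N, d ∉ I ∧ d ∉ O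
  · obtain ⟨d, hd, hdI, hdO⟩ := h1
    obtain ⟨a, l, hl, hlN, haI, haO, hlast, hch⟩ := ih _ (Finset.card_erase_lt_of_mem hd)
      (N.erase d) I O (Finset.subset_erase.2 ⟨hI, hdI⟩) (Finset.subset_erase.2 ⟨hO, hdO⟩)
      hcard hne rfl
    have hdl : d ∉ a :: l := fun h => by
      rw [← List.mem_toFinset, hlN] at h
      simp at h
    refine ⟨a, l ++ [d], ?_, ?_, haI, haO, ?_, ?_⟩
    · rw [← List.cons_append]
      exact hl.append (List.nodup_singleton d) (by simpa using hdl)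
    · rw [← List.cons_append, List.toFinset_append, hlN]
      simp [Finset.insert_erase hd, Finset.union_comm _ {d}]
    · simpa using hdI
    · rw [← List.cons_append]
      refine hch.append (List.isChain_singleton d) ?_
      intro x hx y hy
      rw [List.getLast?_eq_some_getLast (List.cons_ne_nil a l), Option.mem_some_iff] at hx
      simp only [List.head?_cons, Option.mem_some_iff] at hy
      subst hx hy
      exact iff_of_false hlast hdO
  by_cases h2 : ∃ d, d ∈ I ∧ d ∈ O
  · obtain ⟨d, hdI, hdO⟩ := h2
    have hd := hI hdI
    obtain ⟨a, l, hl, hlN, haI, haO, hlast, hch⟩ := ih _ (Finset.card_erase_lt_of_mem hd)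
      (N.erase d) (I.erase d) (O.erase d) (Finset.erase_subset_erase d hI)
      (Finset.erase_subset_erase d hO)
      (by rw [Finset.card_erase_of_mem hdI, Finset.card_erase_of_mem hdO, hcard])
      (fun h => hne (by rw [← Finset.insert_erase hdI, h, Finset.insert_erase hdO])) rfl
    have hdl : d ∉ a :: l := fun h => by
      rw [← List.mem_toFinset, hlN] at h
      simp at h
    obtain _ | ⟨y, l⟩ := l
    · exact absurd haI (by simpa using hlast)
    have had : a ≠ d := fun h => by simp [h] at haI
    have hin : ∀ z ∈ a :: y :: l, z ≠ d := fun z hz h => hdl (h ▸ hz)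
    have hch' : (a :: y :: l).IsChain (fun x y => x ∈ I ↔ y ∈ O) := by
      refine hch.imp_of_mem_imp fun x z hx hz h => ?_
      simpa [hin x hx, hin z hz] using h
    have hyO : y ∈ O := ((List.isChain_cons_cons.1 hch').1).1 (Finset.mem_of_mem_erase haI)
    refine ⟨a, d :: y :: l, ?_, ?_, Finset.mem_of_mem_erase haI, ?_, ?_, ?_⟩
    · simp only [List.nodup_cons, List.mem_cons, not_or] at hl hdl ⊢
      tauto
    · rw [List.toFinset_cons, List.toFinset_cons, Finset.insert_comm, ← List.toFinset_cons, hlN,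
        Finset.insert_erase hd]
    · exact fun h => haO (Finset.mem_erase.2 ⟨had, h⟩)
    · intro h
      apply hlast
      have e : (a :: y :: l).getLast (List.cons_ne_nil _ _) =
        (a :: d :: y :: l).getLast (List.cons_ne_nil _ _) := by simp
      rw [← e] at h
      exact Finset.mem_erase.2 ⟨hin _ (List.getLast_mem _), h⟩
    · simp only [List.isChain_cons_cons] at hch' ⊢
      exact ⟨iff_of_true (Finset.mem_of_mem_erase haI) hdO, iff_of_true hdI hyO, hch'.2⟩
  push Not at h1 h2
  obtain ⟨a, haI⟩ : I.Nonempty := by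
    rw [Finset.nonempty_iff_ne_empty]
    rintro rfl
    exact hne (Finset.card_eq_zero.1 (by rw [← hcard]; rfl)).symm
  obtain ⟨b, hbO⟩ : O.Nonempty := by
    rw [← Finset.card_pos, ← hcard]
    exact Finset.card_pos.2 ⟨a, haI⟩
  have haO := h2 a haI
  have hbI : b ∉ I := fun h => h2 b h hbO
  have hab : a ≠ b := fun h => haO (h ▸ hbO)
  have hNab : insert a (insert b ((N.erase b).erase a)) = N := by
    rw [Finset.insert_comm, Finset.insert_erase (Finset.mem_erase.2 ⟨hab, hI haI⟩),
      Finset.insert_erase (hO hbO)]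
  by_cases h3 : (I.erase a).Nonempty
  · obtain ⟨c, l, hl, hlN, hcI, hcO, hlast, hch⟩ := ih _ (
        (Finset.card_erase_le).trans_lt (Finset.card_erase_lt_of_mem (hO hbO)))
      ((N.erase b).erase a) (I.erase a) (O.erase b)
      (Finset.erase_subset_erase a (Finset.subset_erase.2 ⟨hI, hbI⟩))
      (Finset.subset_erase.2 ⟨Finset.erase_subset_erase b hO, fun h =>
        haO (Finset.mem_of_mem_erase h)⟩)
      (by rw [Finset.card_erase_of_mem haI, Finset.card_erase_of_mem hbO, hcard])
      (fun h => by
        obtain ⟨z, hz⟩ := h3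
        exact h2 z (Finset.mem_of_mem_erase hz) (Finset.mem_of_mem_erase (h ▸ hz))) rfl
    have hin : ∀ z ∈ c :: l, z ≠ a ∧ z ≠ b := fun z hz => by
      rw [← List.mem_toFinset, hlN] at hz
      simp only [Finset.mem_erase] at hz
      exact ⟨hz.1, hz.2.1⟩
    have hcO' : c ∉ O := fun h => hcO (Finset.mem_erase.2 ⟨(hin c (by simp)).2, h⟩)
    refine ⟨a, b :: c :: l, ?_, ?_, haI, haO, ?_, ?_⟩
    · rw [List.nodup_cons, List.nodup_cons, List.mem_cons, not_or]
      exact ⟨⟨hab, fun h => (hin a h).1 rfl⟩, fun h => (hin b h).2 rfl, hl⟩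
    · rw [List.toFinset_cons, List.toFinset_cons, hlN, hNab]
    · intro h
      apply hlast
      have e : (c :: l).getLast (List.cons_ne_nil _ _) =
        (a :: b :: c :: l).getLast (List.cons_ne_nil _ _) := by simp
      rw [← e] at h
      exact Finset.mem_erase.2 ⟨(hin _ (List.getLast_mem _)).1, h⟩
    · refine List.isChain_cons_cons.2 ⟨iff_of_true haI hbO, List.isChain_cons_cons.2
        ⟨iff_of_false hbI hcO', hch.imp_of_mem_imp fun x z hx hz h => ?_⟩⟩
      simpa [(hin x hx).1, (hin z hz).2] using h
  · rw [Finset.not_nonempty_iff_eq_empty] at h3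
    have hO0 : O.erase b = ∅ := by
      rw [← Finset.card_eq_zero, Finset.card_erase_of_mem hbO, ← hcard,
        ← Finset.card_erase_of_mem haI, h3, Finset.card_empty]
    refine ⟨a, [b], by simpa using hab, ?_, haI, haO, by simpa using hbI, ?_⟩
    · rw [← hNab]
      suffices (N.erase b).erase a = ∅ by simp [this]
      rw [Finset.eq_empty_iff_forall_notMem]
      intro z hz
      simp only [Finset.mem_erase] at hz
      by_cases hzI : z ∈ I
      · simpa [h3] using Finset.mem_erase.2 ⟨hz.1, hzI⟩
      · simpa [hO0] using Finset.mem_erase.2 ⟨hz.2.1, h1 z hz.2.2 hzI⟩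
    · simpa using iff_of_true haI hbO

/-- A cyclic permutation of a finite set can be chosen to map a subset `I` onto another subset `O`
of the same size, unless `I = O` is a proper nonempty subset. -/
theorem exists_isCycleOn_mem_iff (N I O : Finset α) (hI : I ⊆ N) (hO : O ⊆ N)
    (hcard : I.card = O.card) (h : I ≠ O ∨ I = N ∧ O = N) :
    ∃ ρ : Perm α, ρ.IsCycleOn N ∧ ∀ x ∈ N, x ∈ I ↔ ρ x ∈ O := by
  rcases h with h | ⟨rfl, rfl⟩
  · obtain ⟨a, l, hl, rfl, haI, haO, hlast, hch⟩ := exists_list_isChain_mem_iff N I O hI hO hcard h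
    have hcyc : (a :: l).formPerm.IsCycleOn ((a :: l).toFinset : Set α) := by
      rw [List.coe_toFinset]
      exact hl.isCycleOn_formPerm
    refine ⟨(a :: l).formPerm, hcyc, fun x hx => ?_⟩
    rw [List.mem_toFinset] at hx
    obtain ⟨i, hi, rfl⟩ := List.getElem_of_mem hx
    rcases Nat.lt_or_ge (i + 1) (a :: l).length with h' | h'
    · rw [List.formPerm_apply_lt_getElem _ hl _ h']
      exact List.isChain_iff_getElem.1 hch i h'
    · have e : (a :: l)[i] = (a :: l).getLast (List.cons_ne_nil a l) := by
        rw [List.getLast_eq_getElem]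
        congr 1
        omega
      rw [e, List.formPerm_apply_getLast]
      exact iff_of_false hlast haO
  · obtain ⟨ρ, hρ, -⟩ := O.countable_toSet.exists_cycleOn
    exact ⟨ρ, hρ, fun x hx => iff_of_true hx (hρ.1.mapsTo hx)⟩

end LocalRotation

section EvenEdgeSets

open SimpleGraph

variable {V : Type*} [DecidableEq V]

/-- The number of edges in `S` at `v`. -/
def edgeDegree (S : Finset (Sym2 V)) (v : V) : ℕ := (S.filter (v ∈ ·)).card

theorem edgeDegree_sdiff_add {S C : Finset (Sym2 V)} (h : C ⊆ S) (v : V) :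
    edgeDegree (S \ C) v + edgeDegree C v = edgeDegree S v := by
  rw [edgeDegree, edgeDegree, edgeDegree, ← Finset.card_union_of_disjoint, ← Finset.filter_union,
    Finset.sdiff_union_of_subset h]
  exact Finset.disjoint_filter_filter Finset.sdiff_disjoint

/-- The set `O` of arcs is an orientation of the set `S` of edges with equal numbers of incoming
and outgoing arcs at each vertex. -/
structure IsBalancedOrientation (S : Finset (Sym2 V)) (O : Finset (V × V)) : Prop where
  image_eq : O.image (fun e => s(e.1, e.2)) = S
  asymm : ∀ u v, (u, v) ∈ O → (v, u) ∉ O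
  balanced : ∀ v, (O.filter (·.1 = v)).card = (O.filter (·.2 = v)).card

namespace IsBalancedOrientation

variable {S : Finset (Sym2 V)} {O : Finset (V × V)}

theorem mem_iff (h : IsBalancedOrientation S O) (u v : V) :
    s(u, v) ∈ S ↔ (u, v) ∈ O ∨ (v, u) ∈ O := by
  rw [← h.image_eq, Finset.mem_image]
  constructor
  · rintro ⟨⟨a, b⟩, hab, e⟩
    rcases Sym2.eq_iff.1 e with ⟨rfl, rfl⟩ | ⟨rfl, rfl⟩
    · exact .inl hab
    · exact .inr hab
  · rintro (h | h)
    · exact ⟨_, h, rfl⟩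
    · exact ⟨_, h, Sym2.eq_swap⟩

theorem injOn (h : IsBalancedOrientation S O) :
    Set.InjOn (fun e : V × V => s(e.1, e.2)) (O : Set (V × V)) := by
  rintro ⟨a, b⟩ hab ⟨c, d⟩ hcd e
  rcases Sym2.eq_iff.1 e with ⟨h1, h2⟩ | ⟨h1, h2⟩
  · exact Prod.ext h1 h2
  · dsimp only at h1 h2
    subst h1 h2
    exact absurd hcd (h.asymm _ _ hab)

theorem card_eq (h : IsBalancedOrientation S O) : O.card = S.card := by
  rw [← h.image_eq, Finset.card_image_of_injOn h.injOn]

theorem edgeDegree_eq (h : IsBalancedOrientation S O) (v : V) :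
    edgeDegree S v = 2 * (O.filter (·.2 = v)).card := by
  have hdisj : Disjoint (O.filter (·.1 = v)) (O.filter (·.2 = v)) := by
    rw [Finset.disjoint_left]
    rintro ⟨a, b⟩ h1 h2
    simp only [Finset.mem_filter] at h1 h2
    obtain ⟨hab, rfl⟩ := h1
    obtain ⟨-, rfl⟩ := h2
    exact h.asymm _ _ hab hab
  rw [two_mul]
  nth_rewrite 1 [← h.balanced]
  rw [← Finset.card_union_of_disjoint hdisj, ← Finset.filter_or,
    ← Finset.card_image_of_injOn (h.injOn.mono (Finset.coe_subset.2 (Finset.filter_subset _ _))),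
    edgeDegree, ← h.image_eq, Finset.filter_image]
  simp only [Sym2.mem_iff, eq_comm]

theorem union {S' : Finset (Sym2 V)} {O' : Finset (V × V)} (h : IsBalancedOrientation S O)
    (h' : IsBalancedOrientation S' O') (hdisj : Disjoint S S') :
    IsBalancedOrientation (S ∪ S') (O ∪ O') := by
  have hne : ∀ u v, (u, v) ∈ O → (u, v) ∉ O' ∧ (v, u) ∉ O' := fun u v huv => by
    have := Finset.disjoint_left.1 hdisj ((h.mem_iff u v).2 (.inl huv))
    rwa [h'.mem_iff, not_or] at this
  have hO : Disjoint O O' := Finset.disjoint_left.2 fun e he => (hne e.1 e.2 he).1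
  refine ⟨by rw [Finset.image_union, h.image_eq, h'.image_eq], fun u v huv hvu => ?_, fun v => ?_⟩
  · rcases Finset.mem_union.1 huv with h1 | h1 <;> rcases Finset.mem_union.1 hvu with h2 | h2
    · exact h.asymm _ _ h1 h2
    · exact (hne _ _ h1).2 h2
    · exact (hne _ _ h2).2 h1
    · exact h'.asymm _ _ h1 h2
  · rw [Finset.filter_union, Finset.filter_union,
      Finset.card_union_of_disjoint (Finset.disjoint_filter_filter hO),
      Finset.card_union_of_disjoint (Finset.disjoint_filter_filter hO), h.balanced, h'.balanced]

end IsBalancedOrientation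

theorem exists_cycle_of_not_isAcyclic {S : Finset (Sym2 V)}
    (h : ¬ (fromEdgeSet (S : Set (Sym2 V))).IsAcyclic) :
    ∃ C ⊆ S, C.Nonempty ∧ (∃ O, IsBalancedOrientation C O) ∧
      ∀ v, edgeDegree C v = 0 ∨ edgeDegree C v = 2 := by
  simp only [IsAcyclic, not_forall, not_not] at h
  obtain ⟨u, c, hc⟩ := h
  have hnd : c.edges.Nodup := hc.edges_nodup
  have hnd' : (c.darts.map Dart.toProd).Nodup :=
    (List.Nodup.of_map _ hnd).map Dart.toProd_injective
  have hcard : ∀ (f : V × V → V) v, ((c.darts.map Dart.toProd).toFinset.filter (f · = v)).card =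
      (c.darts.map fun d => f d.toProd).count v := by
    intro f v
    have e : (c.darts.map Dart.toProd).toFinset.filter (f · = v) =
        ((c.darts.map Dart.toProd).filter (f · == v)).toFinset := by
      ext
      simp
    rw [e, List.toFinset_card_of_nodup (hnd'.filter _), ← List.countP_eq_length_filter,
      List.countP_map, List.count, List.countP_map]
    rfl
  have h1 : ∀ v, c.support.dropLast.count v = c.support.tail.count v := by
    intro v
    have e1 := congrArg (List.count v) (c.cons_map_snd_darts)
    have e2 := congrArg (List.count v) (c.map_fst_darts_append)
    rw [Walk.map_snd_darts, List.count_cons] at e1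
    rw [Walk.map_fst_darts, List.count_append, List.count_singleton] at e2
    omega
  have hO : IsBalancedOrientation c.edges.toFinset (c.darts.map Dart.toProd).toFinset := by
    refine ⟨?_, fun a b hab hba => ?_, fun v => ?_⟩
    · ext e
      simp [Walk.edges, Dart.edge]
    · simp only [List.mem_toFinset, List.mem_map] at hab hba
      obtain ⟨d, hd, e⟩ := hab
      obtain ⟨d', hd', e'⟩ := hba
      have := List.inj_on_of_nodup_map hnd hd hd' (by
        rw [Dart.edge, Dart.edge, e, e']
        exact Sym2.eq_swap)
      subst this
      have hadj := d.adj
      rw [e] at hadj e'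
      exact hadj.ne (congrArg Prod.fst e')
    · rw [hcard, hcard, Walk.map_fst_darts, Walk.map_snd_darts, h1]
  refine ⟨c.edges.toFinset, fun e he => ?_, ?_, ⟨_, hO⟩, fun v => ?_⟩
  · have := c.edges_subset_edgeSet (List.mem_toFinset.1 he)
    rw [edgeSet_fromEdgeSet] at this
    exact this.1
  · rw [List.toFinset_nonempty_iff, Ne, Walk.edges_eq_nil]
    exact hc.not_nil
  · have h2 : c.support.tail.count v ≤ 1 := List.nodup_iff_count_le_one.1 hc.support_nodup v
    rw [hO.edgeDegree_eq, hcard, Walk.map_snd_darts]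
    omega

theorem not_isAcyclic_of_edgeDegree_ne_one {S : Finset (Sym2 V)} (hS : S.Nonempty)
    (hloop : ∀ e ∈ S, ¬ e.IsDiag) (hdeg : ∀ v, edgeDegree S v ≠ 1) :
    ¬ (fromEdgeSet (S : Set (Sym2 V))).IsAcyclic := by
  intro h
  obtain ⟨e, he⟩ := hS
  induction e with | _ a b
  have hab : (fromEdgeSet (S : Set (Sym2 V))).Adj a b := by
    simpa using And.intro he (hloop _ he)
  have : Finite (fromEdgeSet (S : Set (Sym2 V))).edgeSet := by
    rw [edgeSet_fromEdgeSet]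
    exact (S.finite_toSet.subset Set.sdiff_subset)
  have : Nonempty V := ⟨a⟩
  obtain ⟨u, v, p, hp, hmax⟩ :=
    Walk.exists_isPath_forall_isPath_length_le_length (fromEdgeSet (S : Set (Sym2 V)))
  have hnil : ¬p.Nil := fun hn => by
    have := hmax _ _ hab.toWalk (by simp [hab.ne])
    rw [Walk.length_eq_zero_iff.2 hn] at this
    simp at this
  apply hdeg v
  rw [edgeDegree, Finset.card_eq_one]
  have hpen := p.adj_penultimate hnil
  refine ⟨s(v, p.penultimate), ?_⟩
  ext f
  simp only [Finset.mem_filter, Finset.mem_singleton]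
  constructor
  · rintro ⟨hf, hv⟩
    obtain ⟨w, rfl⟩ := Sym2.mem_iff_exists.1 hv
    have hadj : (fromEdgeSet (S : Set (Sym2 V))).Adj v w := by
      simpa using And.intro hf (hloop _ hf)
    rw [h.eq_penultimate_of_adj_end hp hadj]
    by_contra hw
    have := hmax _ _ (p.concat hadj) (hp.concat hw hadj)
    simp at this
  · rintro rfl
    exact ⟨by simpa using ((fromEdgeSet_adj _).1 hpen.symm).1, Sym2.mem_mk_left _ _⟩

theorem exists_isBalancedOrientation (S : Finset (Sym2 V)) (hloop : ∀ e ∈ S, ¬ e.IsDiag)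
    (hS : ∀ v, Even (edgeDegree S v)) : ∃ O, IsBalancedOrientation S O := by
  induction S using Finset.strongInduction with
  | _ S ih =>
  rcases S.eq_empty_or_nonempty with rfl | hne
  · exact ⟨∅, by simp, by simp, by simp⟩
  obtain ⟨C, hCS, hC, ⟨O, hO⟩, hdeg⟩ := exists_cycle_of_not_isAcyclic
    (not_isAcyclic_of_edgeDegree_ne_one hne hloop fun v h => by simpa [h] using hS v)
  obtain ⟨O', hO'⟩ := ih _ (Finset.sdiff_ssubset hCS hC)
    (fun e he => hloop e (Finset.sdiff_subset he)) fun v => by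
      have h1 := hS v
      rw [← edgeDegree_sdiff_add hCS v, Nat.even_add] at h1
      exact h1.2 (by rcases hdeg v with h | h <;> simp [h])
  have := hO'.union hO Finset.sdiff_disjoint
  rw [Finset.sdiff_union_of_subset hCS] at this
  exact ⟨_, this⟩

end EvenEdgeSets

section EvenSubsets

open SimpleGraph

variable {V : Type*}

theorem card_add_one_le_of_isAcyclic [Fintype V] [Nonempty V] {S : Finset (Sym2 V)}
    (hloop : ∀ e ∈ S, ¬ e.IsDiag) (h : (fromEdgeSet (S : Set (Sym2 V))).IsAcyclic) :
    S.card + 1 ≤ Fintype.card V := by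
  classical
  obtain ⟨T, hST, -, hT⟩ := (connected_top (V := V)).exists_isTree_le_of_le_of_isAcyclic le_top h
  rw [← hT.card_edgeFinset]
  gcongr
  intro e he
  rw [mem_edgeFinset]
  apply edgeSet_mono hST
  rw [edgeSet_fromEdgeSet]
  exact ⟨he, hloop e he⟩

variable [DecidableEq V]

theorem edgeDegree_mono {S S' : Finset (Sym2 V)} (h : S ⊆ S') (v : V) :
    edgeDegree S v ≤ edgeDegree S' v :=
  Finset.card_le_card (Finset.filter_subset_filter _ h)

theorem edgeDegree_union {S S' : Finset (Sym2 V)} (h : Disjoint S S') (v : V) :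
    edgeDegree (S ∪ S') v = edgeDegree S v + edgeDegree S' v := by
  rw [edgeDegree, Finset.filter_union,
    Finset.card_union_of_disjoint (Finset.disjoint_filter_filter h), edgeDegree, edgeDegree]

theorem edgeDegree_sdiff_add_inter (S C : Finset (Sym2 V)) (v : V) :
    edgeDegree (S \ C) v + edgeDegree (S ∩ C) v = edgeDegree S v := by
  rw [← edgeDegree_sdiff_add (Finset.inter_subset_left (s₁ := S) (s₂ := C)),
    Finset.sdiff_inter_self_left]

theorem edgeDegree_eq_zero {S : Finset (Sym2 V)} {v : V} :
    edgeDegree S v = 0 ↔ ∀ e ∈ S, v ∉ e := by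
  rw [edgeDegree, Finset.card_eq_zero, Finset.filter_eq_empty_iff]

theorem edgeDegree_lt_of_mem {S S' : Finset (Sym2 V)} (h : S ⊆ S') {v : V} {e : Sym2 V}
    (he : e ∈ S') (he' : e ∉ S) (hv : v ∈ e) : edgeDegree S v < edgeDegree S' v :=
  Finset.card_lt_card <| (Finset.ssubset_iff_of_subset (Finset.filter_subset_filter _ h)).2
    ⟨e, by simp [he, hv], by simp [he']⟩

theorem edgeDegree_insert_of_notMem (S : Finset (Sym2 V)) {v : V} {e : Sym2 V} (hv : v ∉ e) :
    edgeDegree (insert e S) v = edgeDegree S v := by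
  rw [edgeDegree, Finset.filter_insert, if_neg hv, edgeDegree]

theorem edgeDegree_insert_le (S : Finset (Sym2 V)) (v : V) (e : Sym2 V) :
    edgeDegree (insert e S) v ≤ edgeDegree S v + 1 := by
  rw [edgeDegree, Finset.filter_insert, edgeDegree]
  split_ifs
  · exact Finset.card_insert_le _ _
  · omega

/-- The part of a greedy selection of edges that picks the edge `e` and discards the edges in
`R`. -/
theorem exists_subset_edgeDegree_le_one_step {E R : Finset (Sym2 V)} {W W' : Finset V} {e : Sym2 V}
    (heE : e ∈ E) (heR : e ∈ R)
    (h1 : ∀ v ∈ W, v ∈ e → edgeDegree (E \ R) v = 0)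
    (h2 : ∀ v ∈ W, v ∉ W' → edgeDegree (E \ R) v ≤ 1)
    (h3 : 3 * R.card + W'.card ≤ 6 + W.card)
    (ih : ∃ M ⊆ E \ R, (∀ v ∈ W', edgeDegree M v ≤ 1) ∧
      3 * (E \ R).card ≤ 6 * M.card + W'.card) :
    ∃ M ⊆ E, (∀ v ∈ W, edgeDegree M v ≤ 1) ∧ 3 * E.card ≤ 6 * M.card + W.card := by
  obtain ⟨M, hM, hdeg, hcard⟩ := ih
  have heM : e ∉ M := fun h => (Finset.mem_sdiff.1 (hM h)).2 heR
  refine ⟨insert e M, Finset.insert_subset heE (hM.trans Finset.sdiff_subset), fun v hv => ?_, ?_⟩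
  · by_cases hve : v ∈ e
    · have := edgeDegree_insert_le M v e
      have := edgeDegree_mono hM v
      have := h1 v hv hve
      omega
    · rw [edgeDegree_insert_of_notMem M hve]
      by_cases hv' : v ∈ W'
      · exact hdeg v hv'
      · exact (edgeDegree_mono hM v).trans (h2 v hv hv')
  · rw [Finset.card_insert_of_notMem heM]
    have := Finset.le_card_sdiff R E
    omega

/-- In a set `E` of edges one can select a subset with at most one edge at each vertex of `W`, of
size at least `|E| / 2 - |W| / 6`, if each vertex of `W` lies on at most two edges of `E`. -/
theorem exists_subset_edgeDegree_le_one (E : Finset (Sym2 V)) (hloop : ∀ e ∈ E, ¬ e.IsDiag)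
    (W : Finset V) (hW : ∀ v ∈ W, edgeDegree E v ≤ 2) :
    ∃ M ⊆ E, (∀ v ∈ W, edgeDegree M v ≤ 1) ∧ 3 * E.card ≤ 6 * M.card + W.card := by
  induction E using Finset.strongInduction generalizing W with
  | _ E ih =>
  rcases E.eq_empty_or_nonempty with rfl | ⟨e₀, he₀⟩
  · exact ⟨∅, by simp, by simp [edgeDegree], by simp⟩
  have ih' : ∀ {R : Finset (Sym2 V)} {W' : Finset V} {e : Sym2 V}, e ∈ R → e ∈ E → W' ⊆ W →
      ∃ M ⊆ E \ R, (∀ v ∈ W', edgeDegree M v ≤ 1) ∧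
        3 * (E \ R).card ≤ 6 * M.card + W'.card := fun {R W' e} he heE hWW => by
    refine ih _ ((Finset.ssubset_iff_of_subset Finset.sdiff_subset).2 ⟨e, heE, by simp [he]⟩)
      (fun f hf => hloop f (Finset.sdiff_subset hf)) W' fun v hv => ?_
    exact (edgeDegree_mono Finset.sdiff_subset v).trans (hW v (hWW hv))
  by_cases hcase : ∃ e ∈ E, ∃ a ∈ e, a ∈ W → edgeDegree E a ≤ 1
  · obtain ⟨e, he, a, hae, ha⟩ := hcase
    obtain ⟨b, rfl⟩ := Sym2.mem_iff_exists.1 hae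
    have key : ∀ R : Finset (Sym2 V), s(a, b) ∈ R → R.card ≤ 2 →
        (b ∈ W → edgeDegree (E \ R) b = 0) →
        ∃ M ⊆ E, (∀ v ∈ W, edgeDegree M v ≤ 1) ∧ 3 * E.card ≤ 6 * M.card + W.card := by
      intro R heR hR hb
      refine exists_subset_edgeDegree_le_one_step he heR (fun v hv hve => ?_)
        (fun v hv hv' => absurd hv hv') (by omega) (ih' heR he (Finset.Subset.refl W))
      rcases Sym2.mem_iff.1 hve with rfl | rfl
      · have := edgeDegree_lt_of_mem (Finset.sdiff_subset (s := E) (t := R)) he (by simp [heR]) hae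
        have := ha hv
        omega
      · exact hb hv
    by_cases hbW : b ∈ W
    · refine key (E.filter (b ∈ ·)) (by simp [he]) (hW b hbW) fun _ => ?_
      rw [edgeDegree_eq_zero]
      simp +contextual
    · exact key {s(a, b)} (by simp) (by simp) fun h => absurd h hbW
  · push Not at hcase
    induction e₀ with | _ a b
    obtain ⟨haW, hda⟩ := hcase _ he₀ a (Sym2.mem_mk_left a b)
    obtain ⟨hbW, hdb⟩ := hcase _ he₀ b (Sym2.mem_mk_right a b)
    obtain ⟨f, hf, hfe⟩ := Finset.exists_mem_ne hda s(a, b)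
    rw [Finset.mem_filter] at hf
    obtain ⟨c, rfl⟩ := Sym2.mem_iff_exists.1 hf.2
    obtain ⟨hcW, hdc⟩ := hcase _ hf.1 c (Sym2.mem_mk_right a c)
    have hab : a ≠ b := fun h => hloop _ he₀ h
    have hac : a ≠ c := fun h => hloop _ hf.1 h
    have hbc : b ≠ c := fun h => hfe (by rw [h])
    have heR : s(a, b) ∈ E.filter (fun e => a ∈ e ∨ b ∈ e) := by simp [he₀]
    have hsub : ({a, b, c} : Finset V) ⊆ W := by
      simp [Finset.insert_subset_iff, haW, hbW, hcW]
    have hdeg : ∀ v ∈ s(a, b), edgeDegree (E \ E.filter (fun e => a ∈ e ∨ b ∈ e)) v = 0 := by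
      intro v hv
      rw [edgeDegree_eq_zero]
      rcases Sym2.mem_iff.1 hv with rfl | rfl <;> simp +contextual
    refine exists_subset_edgeDegree_le_one_step (W' := W \ {a, b, c}) he₀ heR
      (fun v _ => hdeg v) (fun v hv hv' => ?_) ?_ (ih' heR he₀ Finset.sdiff_subset)
    · simp only [Finset.mem_sdiff, hv, true_and, not_not, Finset.mem_insert,
        Finset.mem_singleton] at hv'
      rcases hv' with rfl | rfl | rfl
      · simp [hdeg v (Sym2.mem_mk_left _ _)]
      · simp [hdeg v (Sym2.mem_mk_right _ _)]
      · have := edgeDegree_lt_of_mem (v := v) (Finset.sdiff_subset (s := E)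
          (t := E.filter (fun e => a ∈ e ∨ b ∈ e))) hf.1 (by simp [hf.1]) (Sym2.mem_mk_right _ _)
        have := hW v hv
        omega
    · have h1 := Finset.card_union_add_card_inter (E.filter (a ∈ ·)) (E.filter (b ∈ ·))
      have h2 : 0 < (E.filter (a ∈ ·) ∩ E.filter (b ∈ ·)).card :=
        Finset.card_pos.2 ⟨s(a, b), by simp [he₀]⟩
      have h3 := hW a haW
      have h4 := hW b hbW
      have h5 := Finset.card_sdiff_add_card_eq_card hsub
      have h6 : ({a, b, c} : Finset V).card = 3 :=
        Finset.card_eq_three.2 ⟨a, b, c, hab, hac, hbc, rfl⟩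
      rw [edgeDegree] at h3 h4
      rw [Finset.filter_or]
      omega

/-- The edges of `B` with an end that lies on no edge of `S`. -/
noncomputable def edgesAtUncovered (B S : Finset (Sym2 V)) : Finset (Sym2 V) :=
  open Classical in B.filter fun e => ∃ v ∈ e, edgeDegree S v = 0

theorem mem_edgesAtUncovered {B S : Finset (Sym2 V)} {e : Sym2 V} :
    e ∈ edgesAtUncovered B S ↔ e ∈ B ∧ ∃ v ∈ e, edgeDegree S v = 0 := by
  simp [edgesAtUncovered]

theorem exists_even_subset_card_le [Fintype V] [Nonempty V] (B : Finset (Sym2 V))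
    (hloop : ∀ e ∈ B, ¬ e.IsDiag) :
    ∃ S ⊆ B, (∀ v, Even (edgeDegree S v)) ∧
      3 * (2 * (edgesAtUncovered B S).card + S.card) + 6 ≤ 7 * Fintype.card V := by
  classical
  obtain ⟨S, hS, hmin⟩ := Finset.exists_min_image
    (B.powerset.filter fun S => ∀ v, Even (edgeDegree S v))
    (fun S => 2 * (edgesAtUncovered B S).card + S.card)
    ⟨∅, Finset.mem_filter.2 ⟨by simp, by simp [edgeDegree]⟩⟩
  simp only [Finset.mem_filter, Finset.mem_powerset, and_imp] at hS hmin
  obtain ⟨hSB, heven⟩ := hS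
  refine ⟨S, hSB, heven, ?_⟩
  obtain ⟨M, hMS, hMdeg, hMcard⟩ := exists_subset_edgeDegree_le_one S (fun e he => hloop e (hSB he))
    (Finset.univ.filter fun v => edgeDegree S v = 2) (by simp +contextual)
  have hW : (Finset.univ.filter fun v => edgeDegree S v = 2).card ≤ Fintype.card V :=
    Finset.card_filter_le _ _
  set U := edgesAtUncovered B S with hU
  have hUB : U ⊆ B := fun e he => (mem_edgesAtUncovered.1 he).1
  have hUS : Disjoint U S := Finset.disjoint_left.2 fun e he heS => by
    obtain ⟨-, v, hv, h0⟩ := mem_edgesAtUncovered.1 he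
    exact edgeDegree_eq_zero.1 h0 e heS hv
  suffices (fromEdgeSet ((U ∪ M : Finset (Sym2 V)) : Set (Sym2 V))).IsAcyclic by
    have := card_add_one_le_of_isAcyclic (fun e he => hloop e
      (Finset.union_subset hUB (hMS.trans hSB) he)) this
    rw [Finset.card_union_of_disjoint (hUS.mono_right hMS)] at this
    omega
  by_contra hcyc
  obtain ⟨C, hC, hCne, -, hCdeg⟩ := exists_cycle_of_not_isAcyclic hcyc
  have hCB : C ⊆ B := hC.trans (Finset.union_subset hUB (hMS.trans hSB))
  have hCS : C \ S ⊆ U := fun e he => by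
    rw [Finset.mem_sdiff] at he
    exact (Finset.mem_union.1 (hC he.1)).resolve_right fun h => he.2 (hMS h)
  have hSC : S ∩ C ⊆ M := fun e he => by
    rw [Finset.mem_inter] at he
    exact (Finset.mem_union.1 (hC he.2)).resolve_left fun h => Finset.disjoint_left.1 hUS h he.1
  have hdisj : Disjoint (S \ C) (C \ S) := disjoint_sdiff_sdiff
  have hdeg := fun v => edgeDegree_union hdisj v
  have hdegS := edgeDegree_sdiff_add_inter S C
  have hdegC := edgeDegree_sdiff_add_inter C S
  rw [Finset.inter_comm] at hdegC
  have hcov : ∀ v, edgeDegree (S \ C ∪ C \ S) v = 0 → edgeDegree S v = 0 := by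
    intro v h0
    by_contra hv
    have h1 := hdeg v
    have h2 := hdegS v
    have h3 := hdegC v
    have h4 := edgeDegree_mono hSC v
    have h5 := hCdeg v
    have h6 := hMdeg v (by simp; omega)
    omega
  have hle := hmin (S \ C ∪ C \ S)
    (Finset.union_subset (Finset.sdiff_subset.trans hSB) (Finset.sdiff_subset.trans hCB)) fun v => by
      have h1 := hdeg v
      have h2 := hdegS v
      have h3 := hdegC v
      have h5 := hCdeg v
      have h6 := heven v
      rw [Nat.even_iff] at h6 ⊢
      omega
  have hU' : edgesAtUncovered B (S \ C ∪ C \ S) ⊆ U \ (C \ S) := by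
    intro e he
    obtain ⟨heB, v, hv, h0⟩ := mem_edgesAtUncovered.1 he
    refine Finset.mem_sdiff.2 ⟨mem_edgesAtUncovered.2 ⟨heB, v, hv, hcov v h0⟩, fun h => ?_⟩
    exact edgeDegree_eq_zero.1 h0 e (Finset.mem_union_right _ h) hv
  have h1 := Finset.card_le_card hU'
  have h2 := Finset.card_sdiff_add_card_eq_card hCS
  have h3 := Finset.card_union_of_disjoint hdisj
  have h4 := Finset.card_sdiff_add_card_inter S C
  have h5 := Finset.card_sdiff_add_card_inter C S
  rw [Finset.inter_comm] at h5
  have h6 := Finset.card_pos.2 hCne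
  omega

end EvenSubsets

section Traversal

open SimpleGraph

variable {V : Type*} [Fintype V] [DecidableEq V]

theorem card_filter_adj_le (G : SimpleGraph V) [DecidableRel G.Adj] :
    (Finset.univ.filter fun e : V × V => G.Adj e.1 e.2).card ≤ 2 * G.edgeFinset.card := by
  rw [← dart_card_eq_twice_card_edges, ← Finset.card_univ,
    ← Finset.card_image_of_injective _ Dart.toProd_injective]
  refine Finset.card_le_card fun e he => ?_
  rw [Finset.mem_filter] at he
  exact Finset.mem_image.2 ⟨⟨e, he.2⟩, Finset.mem_univ _, rfl⟩

theorem exists_rotation_of_isBalancedOrientation {G D : SimpleGraph V} (hDG : D ≤ G)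
    {S : Finset (Sym2 V)} {O : Finset (V × V)} (hO : IsBalancedOrientation S O)
    (hSG : ∀ u v, s(u, v) ∈ S → G.Adj u v ∧ ¬ D.Adj u v)
    (hcov : ∀ u v, G.Adj u v → ¬ D.Adj u v → edgeDegree S v ≠ 0) (v : V) :
    ∃ ρ : Perm V, ρ.IsCycleOn (G.neighborSet v) ∧
      ∀ u, (D.Adj u v ∨ (u, v) ∈ O) ↔ (D.Adj v (ρ u) ∨ (v, ρ u) ∈ O) := by
  classical
  have hOG : ∀ u v, (u, v) ∈ O → G.Adj u v ∧ ¬ D.Adj u v := fun u v h =>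
    hSG u v ((hO.mem_iff u v).2 (.inl h))
  have hcard : (Finset.univ.filter fun u => D.Adj u v ∨ (u, v) ∈ O).card =
      (Finset.univ.filter fun u => D.Adj v u ∨ (v, u) ∈ O).card := by
    have e1 : (Finset.univ.filter fun u => (u, v) ∈ O).card = (O.filter (·.2 = v)).card :=
      Finset.card_bij (fun u _ => (u, v)) (by simp) (by simp) (by
        rintro ⟨a, b⟩ h
        simp only [Finset.mem_filter] at h
        obtain ⟨h, rfl⟩ := h
        exact ⟨a, by simpa using h, rfl⟩)
    have e2 : (Finset.univ.filter fun u => (v, u) ∈ O).card = (O.filter (·.1 = v)).card :=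
      Finset.card_bij (fun u _ => (v, u)) (by simp) (by simp) (by
        rintro ⟨a, b⟩ h
        simp only [Finset.mem_filter] at h
        obtain ⟨h, rfl⟩ := h
        exact ⟨b, by simpa using h, rfl⟩)
    rw [Finset.filter_or, Finset.filter_or, Finset.card_union_of_disjoint,
      Finset.card_union_of_disjoint, e1, e2, hO.balanced]
    · simp only [D.adj_comm v]
    · exact Finset.disjoint_filter.2 fun u _ h h' => (hOG _ _ h').2 h
    · exact Finset.disjoint_filter.2 fun u _ h h' => (hOG _ _ h').2 h
  have hIN : ∀ u, (D.Adj u v ∨ (u, v) ∈ O) → G.Adj v u := fun u h =>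
    (h.elim (fun h => hDG h) fun h => (hOG _ _ h).1).symm
  have hON : ∀ u, (D.Adj v u ∨ (v, u) ∈ O) → G.Adj v u := fun u h =>
    h.elim (fun h => hDG h) fun h => (hOG _ _ h).1
  obtain ⟨ρ, hρ, hiff⟩ := exists_isCycleOn_mem_iff (Finset.univ.filter (G.Adj v))
    (Finset.univ.filter fun u => D.Adj u v ∨ (u, v) ∈ O)
    (Finset.univ.filter fun u => D.Adj v u ∨ (v, u) ∈ O)
    (by simpa [Finset.subset_iff] using hIN) (by simpa [Finset.subset_iff] using hON) hcard (by
      by_cases h0 : edgeDegree S v = 0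
      · right
        have hD : ∀ u, G.Adj v u → D.Adj v u := fun u h => by
          by_contra h'
          exact hcov u v h.symm (fun h => h' h.symm) h0
        constructor
        · ext u
          simpa using ⟨hIN u, fun h => .inl (hD u h).symm⟩
        · ext u
          simpa using ⟨hON u, fun h => .inl (hD u h)⟩
      · left
        rw [hO.edgeDegree_eq] at h0
        obtain ⟨⟨u, w⟩, hu⟩ := Finset.card_pos.1 (show 0 < (O.filter (·.2 = v)).card by omega)
        rw [Finset.mem_filter] at hu
        obtain ⟨hu, rfl⟩ := hu
        intro h
        have : u ∈ Finset.univ.filter fun u => D.Adj w u ∨ (w, u) ∈ O := h ▸ by simp [hu]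
        simp only [Finset.mem_filter, Finset.mem_univ, true_and] at this
        exact this.elim (fun h => (hOG _ _ hu).2 h.symm) (hO.asymm _ _ hu))
  have hρ' : ρ.IsCycleOn (G.neighborSet v) := by
    convert hρ using 1
    ext
    simp
  refine ⟨ρ, hρ', fun u => ?_⟩
  by_cases hu : G.Adj v u
  · simpa using hiff u (by simpa using hu)
  · exact iff_of_false (fun h => hu (hIN u h)) fun h => hu (hρ'.apply_mem_iff.1 (hON _ h))

theorem exists_arcs_isRotationSystem (G : SimpleGraph V) (hG : G.Connected) :
    ∃ (A : V → V → Prop) (D : SimpleGraph V) (ρ : V → Perm V), D.Connected ∧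
      (∀ u v, D.Adj u v → A u v) ∧ (∀ u v, A u v → G.Adj u v) ∧
      IsRotationSystem G.neighborSet A ρ ∧
      3 * {e : V × V | A e.1 e.2}.ncard + 12 ≤ 13 * Fintype.card V := by
  classical
  have := hG.nonempty
  obtain ⟨T, hTG, hT⟩ := hG.exists_isTree_le
  obtain ⟨S, hSB, heven, hcard⟩ := exists_even_subset_card_le (G.edgeFinset \ T.edgeFinset)
    fun e he => G.not_isDiag_of_mem_edgeFinset (Finset.sdiff_subset he)
  obtain ⟨O, hO⟩ := exists_isBalancedOrientation S
    (fun e he => G.not_isDiag_of_mem_edgeFinset (Finset.sdiff_subset (hSB he))) heven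
  set U := edgesAtUncovered (G.edgeFinset \ T.edgeFinset) S with hU
  have hUG : ∀ e ∈ U, e ∈ G.edgeSet := fun e he => by
    simpa using (Finset.mem_sdiff.1 (mem_edgesAtUncovered.1 he).1).1
  set D : SimpleGraph V := T ⊔ fromEdgeSet (U : Set (Sym2 V)) with hD
  have hDG : D ≤ G := sup_le hTG fun u v h => hUG s(u, v) ((fromEdgeSet_adj _).1 h).1
  have hSG : ∀ u v, s(u, v) ∈ S → G.Adj u v ∧ ¬ D.Adj u v := fun u v h => by
    have h' := hSB h
    simp only [Finset.mem_sdiff, mem_edgeFinset, mem_edgeSet] at h'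
    refine ⟨h'.1, ?_⟩
    rw [hD, sup_adj, fromEdgeSet_adj, not_or]
    refine ⟨h'.2, fun h2 => ?_⟩
    obtain ⟨-, w, hw, h0⟩ := mem_edgesAtUncovered.1 (Finset.mem_coe.1 h2.1)
    exact edgeDegree_eq_zero.1 h0 _ h hw
  have hcov : ∀ u v, G.Adj u v → ¬ D.Adj u v → edgeDegree S v ≠ 0 := fun u v h h' h0 => by
    rw [hD, sup_adj, fromEdgeSet_adj, not_or] at h'
    exact h'.2 ⟨Finset.mem_coe.2 (mem_edgesAtUncovered.2
      ⟨by simpa using And.intro h h'.1, v, Sym2.mem_mk_right u v, h0⟩), h.ne⟩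
  choose ρ hρ hiff using exists_rotation_of_isBalancedOrientation hDG hO hSG hcov
  refine ⟨fun u v => D.Adj u v ∨ (u, v) ∈ O, D, ρ, hT.connected.mono le_sup_left,
    fun u v => .inl, fun u v h => h.elim (fun h => hDG h) fun h =>
      (hSG u v ((hO.mem_iff u v).2 (.inl h))).1, ⟨hρ, fun u v => hiff v u⟩, ?_⟩
  have e : {e : V × V | D.Adj e.1 e.2 ∨ (e.1, e.2) ∈ O} =
      ((Finset.univ.filter fun e : V × V => D.Adj e.1 e.2) ∪ O : Finset (V × V)) := by
    ext
    simp
  have h1 : (Finset.univ.filter fun e : V × V => D.Adj e.1 e.2).card ≤ 2 * D.edgeFinset.card := by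
    convert card_filter_adj_le D
  have h2 : D.edgeFinset.card ≤ T.edgeFinset.card + U.card := by
    refine le_trans (Finset.card_le_card fun e he => ?_) (Finset.card_union_le _ _)
    rw [mem_edgeFinset, hD, edgeSet_sup, edgeSet_fromEdgeSet] at he
    rw [Finset.mem_union, mem_edgeFinset]
    exact he.imp id fun h => h.1
  have h3 := hT.card_edgeFinset
  have h4 := Finset.card_union_le (Finset.univ.filter fun e : V × V => D.Adj e.1 e.2) O
  have h5 := hO.card_eq
  rw [e, Set.ncard_coe_finset]
  omega

end Traversal

/-- For every finite connected simple graph on `n ≥ 2` vertices there is a port numbering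
and a closed RH-walk visiting all vertices of length `L ≤ 4⅓·n − 4`, i.e. `3L ≤ 13n − 12`. -/
theorem oblivious_periodic_traversal_upper_bound
    {V : Type*} [Fintype V] (G : SimpleGraph V)
    (hconn : G.Connected) (hn : 2 ≤ Fintype.card V) :
    ∃ π : V → V → ℕ, IsPortNumbering G π ∧
      ∃ (L : ℕ) (w : ℕ → V), IsClosedRHWalk G π L w ∧ VisitsAll L w ∧
        3 * L ≤ 13 * Fintype.card V - 12 := by
  classical
  obtain ⟨A, D, ρ₀, hD, hDA, hAG, hρ₀, hcard⟩ := exists_arcs_isRotationSystem G hconn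
  have : Nontrivial V := Fintype.one_lt_card_iff_nontrivial.1 hn
  obtain ⟨a⟩ := hD.nonempty
  obtain ⟨b, hab⟩ := hD.preconnected.exists_adj_of_nontrivial a
  obtain ⟨ρ, e, hρ, he, hvis⟩ := hρ₀.exists_forall_mem_orbit (fun u v h => (hAG u v h).symm) hD hDA
    (e := (a, b)) (hDA _ _ hab)
  choose π hπ hπρ using fun v => exists_numbering_of_isCycleOn (ρ v) (G.neighborSet v)
    (Set.toFinite _) (hρ.isCycleOn v)
  have hper := arcPerm_mem_periodicPts (ρ := ρ) e
  have harc := hρ.arc_iterate he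
  have hpos := minimalPeriod_pos_of_mem_periodicPts hper
  have hsucc : ∀ i, ((arcPerm ρ)^[i + 1] e).1 = ((arcPerm ρ)^[i] e).2 := fun i => by
    rw [iterate_succ_apply', arcPerm_apply]
  refine ⟨π, hπ, minimalPeriod (arcPerm ρ) e, fun i => ((arcPerm ρ)^[i] e).1,
    ⟨hpos, fun i => ?_, fun i => ?_, fun i => ?_⟩, fun v => ?_, ?_⟩
  · simp only [iterate_add_apply, iterate_minimalPeriod]
  · simp only [hsucc]
    exact hAG _ _ (harc i)
  · simp only [hsucc]
    rw [iterate_succ_apply', arcPerm_apply]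
    exact hπρ _ _ (hAG _ _ (harc i)).symm
  · obtain ⟨i, hi⟩ := hvis v
    refine ⟨(i + 1) % minimalPeriod (arcPerm ρ) e, Nat.mod_lt _ hpos, ?_⟩
    simp only [iterate_mod_minimalPeriod_eq]
    rw [hsucc, hi]
  · have h : (Set.Iio (minimalPeriod (arcPerm ρ) e)).ncard ≤ {e : V × V | A e.1 e.2}.ncard :=
      Set.ncard_le_ncard_of_injOn (fun i => (arcPerm ρ)^[i] e) (fun i _ => harc i)
        (iterate_injOn_Iio_minimalPeriod) (Set.toFinite _)
    rw [← Finset.coe_Iio, Set.ncard_coe_finset, Nat.card_Iio] at h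
    omega
end

section
/- There exist a finite type Q of states and a transition function f : Q × ℕ × ℕ → Q × ℕ (a Mealy agent with constant memory) such that for every finite connected simple graph G on n ≥ 2 vertices there exist a port numbering π of G, an initial configuration c_0 = (q, v, i) with 1 ≤ i ≤ deg(v), and an integer L ≥ 1 with 2L ≤ 7n − 4 (i.e., L ≤ 3½·n − 2), such that the agent's trajectory c_0, c_1, c_2, … is well defined (every output port produced along it lies in the valid range of the current vertex), satisfies c_L = c_0, and every vertex of G occurs as the current vertex of some configuration among c_0, …, c_{L−1}. -/
/-- One step of a Mealy agent: from configuration `(s, v, i)` (state, current vertex,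
entry port), with `(s', j) = f (s, i, deg v)`, the step is well defined if
`1 ≤ j ≤ deg v`; the agent moves to the neighbor `w` of `v` with `π v w = j` and the
next configuration is `(s', w, π w v)`. -/
def AgentStep {V Q : Type*} (G : SimpleGraph V) (π : V → V → ℕ)
    (f : Q × ℕ × ℕ → Q × ℕ) (c c' : Q × V × ℕ) : Prop :=
  1 ≤ (f (c.1, c.2.2, portDeg G c.2.1)).2 ∧
  (f (c.1, c.2.2, portDeg G c.2.1)).2 ≤ portDeg G c.2.1 ∧
  G.Adj c.2.1 c'.2.1 ∧
  π c.2.1 c'.2.1 = (f (c.1, c.2.2, portDeg G c.2.1)).2 ∧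
  c'.1 = (f (c.1, c.2.2, portDeg G c.2.1)).1 ∧
  c'.2.2 = π c'.2.1 c.2.1

namespace PeriodicTraversal

/-- The states of the agent. `down` and `probe` enter a vertex, `up`, `upLeaf` and `reject` report
back to the vertex a visit was started from; `hub` and `spoke` serve graphs with a dominating
vertex. -/
inductive AgentState
  | down | probe | up | upLeaf | reject | hub | spoke
  deriving DecidableEq

instance : Fintype AgentState where
  elems := {.down, .probe, .up, .upLeaf, .reject, .hub, .spoke}
  complete s := by cases s <;> decide

open AgentState

/-- The transition function of the agent. -/
def agent : AgentState × ℕ × ℕ → AgentState × ℕ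
  | (down, i, d) =>
    if i = 1 then (if d = 1 then (up, 1) else (down, 2))
    else if i = 2 then (upLeaf, 2) else (reject, i)
  | (probe, i, _) => if i = 1 then (upLeaf, 1) else (reject, i)
  | (up, i, d) => if i < d then (down, i + 1) else (up, 1)
  | (upLeaf, i, d) => if i < d then (probe, i + 1) else (up, 1)
  | (reject, _, _) => (up, 1)
  | (hub, i, d) => (spoke, i % d + 1)
  | (spoke, i, _) => (hub, i)

section Run

variable {V : Type*} {G : SimpleGraph V} {π : V → V → ℕ}

/-- The agent moves from `c` to `c'` in `k` steps, and visits all vertices of `S` before the last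
configuration. -/
def Run (G : SimpleGraph V) (π : V → V → ℕ) (c c' : AgentState × V × ℕ) (k : ℕ) (S : Set V) :
    Prop :=
  ∃ t : ℕ → AgentState × V × ℕ, t 0 = c ∧ t k = c' ∧
    (∀ i < k, AgentStep G π agent (t i) (t (i + 1))) ∧ ∀ v ∈ S, ∃ i < k, (t i).2.1 = v

theorem Run.refl (c : AgentState × V × ℕ) : Run G π c c 0 ∅ :=
  ⟨fun _ => c, rfl, rfl, by simp, by simp⟩

theorem Run.single {c c' : AgentState × V × ℕ} (h : AgentStep G π agent c c') :
    Run G π c c' 1 {c.2.1} :=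
  ⟨fun i => if i = 0 then c else c', by simp, by simp, by simpa using h, by simp⟩

theorem Run.trans {c₁ c₂ c₃ : AgentState × V × ℕ} {k l : ℕ} {S T : Set V}
    (h : Run G π c₁ c₂ k S) (h' : Run G π c₂ c₃ l T) : Run G π c₁ c₃ (k + l) (S ∪ T) := by
  obtain ⟨t, t0, tk, ts, tv⟩ := h
  obtain ⟨u, u0, ul, us, uv⟩ := h'
  refine ⟨fun i => if i < k then t i else u (i - k), ?_, ?_, ?_, ?_⟩
  · by_cases hk : 0 < k
    · simpa [hk] using t0
    · obtain rfl : k = 0 := by omega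
      simp [← t0, tk, u0]
  · simpa using ul
  · intro i hi
    rcases lt_trichotomy (i + 1) k with h1 | h1 | h1
    · simpa [h1, show i < k by omega] using ts i (by omega)
    · have := ts i (by omega)
      simpa [h1, show i < k by omega, ← tk, u0] using this
    · have := us (i - k) (by omega)
      simpa [show ¬ i < k by omega, show ¬ i + 1 < k by omega,
        show i + 1 - k = i - k + 1 by omega] using this
  · rintro v (hv | hv)
    · obtain ⟨i, hi, e⟩ := tv v hv
      exact ⟨i, by omega, by simpa [hi] using e⟩
    · obtain ⟨i, hi, e⟩ := uv v hv
      exact ⟨k + i, by omega, by simpa using e⟩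

theorem Run.mono {c c' : AgentState × V × ℕ} {k : ℕ} {S T : Set V} (h : Run G π c c' k S)
    (hT : T ⊆ S) : Run G π c c' k T := by
  obtain ⟨t, t0, tk, ts, tv⟩ := h
  exact ⟨t, t0, tk, ts, fun v hv => tv v (hT hv)⟩

/-- The start of a nonempty run matters only through the output of the transition function. -/
theorem Run.congr_start {s s' : AgentState} {v : V} {i i' : ℕ} {c' : AgentState × V × ℕ} {k : ℕ}
    {S : Set V} (h : Run G π (s, v, i) c' k S) (hk : 0 < k)
    (hf : agent (s', i', portDeg G v) = agent (s, i, portDeg G v)) :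
    Run G π (s', v, i') c' k S := by
  obtain ⟨t, t0, tk, ts, tv⟩ := h
  refine ⟨fun j => if j = 0 then (s', v, i') else t j, by simp, by simpa [hk.ne'] using tk, ?_, ?_⟩
  · intro j hj
    rcases Nat.eq_zero_or_pos j with rfl | h0
    · have := ts 0 hj
      rw [t0] at this
      simp only [AgentStep] at this ⊢
      simpa [hf] using this
    · simpa [h0.ne'] using ts j hj
  · intro w hw
    obtain ⟨j, hj, e⟩ := tv w hw
    refine ⟨j, hj, ?_⟩
    rcases Nat.eq_zero_or_pos j with rfl | h0
    · simpa [t0] using e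
    · simpa [h0.ne'] using e

/-- A run that returns to its start extends to a periodic trajectory. -/
theorem Run.exists_periodic {c : AgentState × V × ℕ} {k : ℕ} {S : Set V} (h : Run G π c c k S)
    (hk : 0 < k) : ∃ t : ℕ → AgentState × V × ℕ, t 0 = c ∧ t k = c ∧
      (∀ i, AgentStep G π agent (t i) (t (i + 1))) ∧ ∀ v ∈ S, ∃ i < k, (t i).2.1 = v := by
  obtain ⟨t, t0, tk, ts, tv⟩ := h
  refine ⟨fun i => t (i % k), by simpa using t0, by simpa using t0, fun i => ?_, fun v hv => ?_⟩
  · have h1 := ts (i % k) (Nat.mod_lt _ hk)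
    have h2 : t ((i + 1) % k) = t (i % k + 1) := by
      rw [Nat.add_mod]
      rcases Nat.lt_or_ge (i % k + 1) k with h | h
      · rw [Nat.mod_eq_of_lt (a := 1) (by omega), Nat.mod_eq_of_lt h]
      · have h3 : i % k + 1 = k := le_antisymm (Nat.mod_lt _ hk) h
        have : (i % k + 1 % k) % k = 0 := by
          rw [Nat.add_mod_mod, h3, Nat.mod_self]
        rw [this, h3, tk, t0]
    simpa [h2] using h1
  · obtain ⟨i, hi, e⟩ := tv v hv
    exact ⟨i, hi, by simpa [Nat.mod_eq_of_lt hi] using e⟩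

end Run

section Ports

variable {V : Type*} [DecidableEq V]

/-- The port numbering that lists the neighbors of `v` in the order `ord v`. -/
def portOf (ord : V → List V) (v w : V) : ℕ := (ord v).idxOf w + 1

theorem portOf_append {ord : V → List V} {v y : V} {pre suf : List V} (hn : (ord v).Nodup)
    (h : ord v = pre ++ y :: suf) : portOf ord v y = pre.length + 1 := by
  rw [portOf, h]
  rw [h] at hn
  have : y ∉ pre := fun hy => (List.nodup_append.1 hn).2.2 y hy y (by simp) rfl
  rw [List.idxOf_append_of_notMem this]
  simp

theorem portDeg_eq_length {G : SimpleGraph V} {ord : V → List V} {v : V}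
    (hn : (ord v).Nodup) (hm : ∀ w, w ∈ ord v ↔ G.Adj v w) :
    portDeg G v = (ord v).length := by
  have : G.neighborSet v = ((ord v).toFinset : Set V) := by
    ext w; simp [hm]
  rw [portDeg, this, Set.ncard_coe_finset, List.toFinset_card_of_nodup hn]

theorem isPortNumbering_portOf {G : SimpleGraph V} {ord : V → List V}
    (hn : ∀ v, (ord v).Nodup) (hm : ∀ v w, w ∈ ord v ↔ G.Adj v w) :
    IsPortNumbering G (portOf ord) := by
  intro v
  rw [portDeg_eq_length (hn v) (hm v)]
  refine ⟨fun w hw => ?_, fun w hw w' hw' h => ?_, fun i hi => ?_⟩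
  · have := List.idxOf_lt_length_of_mem ((hm v w).2 hw)
    simp only [portOf, Set.mem_Icc]
    omega
  · have h1 := (hm v w).2 hw
    simp only [portOf, Nat.add_right_cancel_iff] at h
    exact (List.idxOf_inj h1).1 h
  · obtain ⟨h1, h2⟩ := hi
    refine ⟨(ord v)[i - 1], (hm v _).1 (List.getElem_mem _), ?_⟩
    rw [portOf, (hn v).idxOf_getElem]
    omega

end Ports

section Visits

variable {V : Type*} [DecidableEq V] {G : SimpleGraph V} {ord : V → List V}

theorem agentStep_portOf (hn : ∀ v, (ord v).Nodup) (hm : ∀ v w, w ∈ ord v ↔ G.Adj v w)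
    {s s' : AgentState} {v y : V} {i : ℕ} {pre suf : List V} (h : ord v = pre ++ y :: suf)
    (hf : agent (s, i, (ord v).length) = (s', pre.length + 1)) :
    AgentStep G (portOf ord) agent (s, v, i) (s', y, portOf ord y v) := by
  have hd := portDeg_eq_length (hn v) (hm v)
  simp only [AgentStep, hd, hf, portOf_append (hn v) h, and_self, and_true]
  refine ⟨by omega, ?_, (hm v y).1 (by simp [h])⟩
  simp [h]

/-- Entering `y` from `v` and leaving through the same port. -/
theorem agentStep_back (hn : ∀ v, (ord v).Nodup) (hm : ∀ v w, w ∈ ord v ↔ G.Adj v w)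
    {s s' : AgentState} {v y : V} (h : G.Adj v y)
    (hf : agent (s, portOf ord y v, (ord y).length) = (s', portOf ord y v)) :
    AgentStep G (portOf ord) agent (s, y, portOf ord y v) (s', v, portOf ord v y) := by
  obtain ⟨pre, suf, e⟩ := List.append_of_mem ((hm y v).2 h.symm)
  refine agentStep_portOf hn hm e ?_
  rw [hf, portOf_append (hn y) e]

theorem run_enter_down (hn : ∀ v, (ord v).Nodup) (hm : ∀ v w, w ∈ ord v ↔ G.Adj v w)
    {v y : V} {pre suf : List V} (h : ord v = pre ++ y :: suf) :
    Run G (portOf ord) (up, v, pre.length) (down, y, portOf ord y v) 1 {v} :=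
  Run.single (agentStep_portOf hn hm h (by simp [agent, h]))

theorem run_enter_probe (hn : ∀ v, (ord v).Nodup) (hm : ∀ v w, w ∈ ord v ↔ G.Adj v w)
    {v y : V} {pre suf : List V} (h : ord v = pre ++ y :: suf) :
    Run G (portOf ord) (upLeaf, v, pre.length) (probe, y, portOf ord y v) 1 {v} :=
  Run.single (agentStep_portOf hn hm h (by simp [agent, h]))

theorem run_exit (hn : ∀ v, (ord v).Nodup) (hm : ∀ v w, w ∈ ord v ↔ G.Adj v w)
    {s : AgentState} {v p : V} {i : ℕ} {l : List V} (h : ord v = p :: l)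
    (hs : s = reject ∨ (s = up ∨ s = upLeaf) ∧ i = (ord v).length) :
    Run G (portOf ord) (s, v, i) (up, p, portOf ord p v) 1 {v} := by
  refine Run.single (agentStep_portOf (pre := []) hn hm h ?_)
  rcases hs with rfl | ⟨rfl | rfl, rfl⟩ <;> simp [agent]

theorem run_down_pendant (hn : ∀ v, (ord v).Nodup) (hm : ∀ v w, w ∈ ord v ↔ G.Adj v w)
    {v y : V} (h : G.Adj v y) (hy : ord y = [v]) :
    Run G (portOf ord) (down, y, portOf ord y v) (up, v, portOf ord v y) 1 {y} :=
  Run.single (agentStep_back hn hm h (by simp [agent, hy, portOf]))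

theorem run_down_two (hn : ∀ v, (ord v).Nodup) (hm : ∀ v w, w ∈ ord v ↔ G.Adj v w)
    {v y : V} (h : G.Adj v y) (hy : portOf ord y v = 2) :
    Run G (portOf ord) (down, y, portOf ord y v) (upLeaf, v, portOf ord v y) 1 {y} :=
  Run.single (agentStep_back hn hm h (by simp [agent, hy]))

theorem run_down_reject (hn : ∀ v, (ord v).Nodup) (hm : ∀ v w, w ∈ ord v ↔ G.Adj v w)
    {v y : V} (h : G.Adj v y) (hy : 3 ≤ portOf ord y v) :
    Run G (portOf ord) (down, y, portOf ord y v) (reject, v, portOf ord v y) 1 {y} :=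
  Run.single (agentStep_back hn hm h (by
    simp [agent, show portOf ord y v ≠ 1 by omega, show portOf ord y v ≠ 2 by omega]))

theorem run_probe_one (hn : ∀ v, (ord v).Nodup) (hm : ∀ v w, w ∈ ord v ↔ G.Adj v w)
    {v y : V} (h : G.Adj v y) (hy : portOf ord y v = 1) :
    Run G (portOf ord) (probe, y, portOf ord y v) (upLeaf, v, portOf ord v y) 1 {y} :=
  Run.single (agentStep_back hn hm h (by simp [agent, hy]))

theorem run_probe_reject (hn : ∀ v, (ord v).Nodup) (hm : ∀ v w, w ∈ ord v ↔ G.Adj v w)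
    {v y : V} (h : G.Adj v y) (hy : 2 ≤ portOf ord y v) :
    Run G (portOf ord) (probe, y, portOf ord y v) (reject, v, portOf ord v y) 1 {y} :=
  Run.single (agentStep_back hn hm h (by
    simp [agent, show portOf ord y v ≠ 1 by omega]))

theorem exists_eq_cons_of_portOf_eq_one (hn : ∀ v, (ord v).Nodup)
    (hm : ∀ v w, w ∈ ord v ↔ G.Adj v w) {v y : V} (h : G.Adj y v) (hy : portOf ord y v = 1) :
    ∃ l, ord y = v :: l := by
  obtain ⟨pre, suf, e⟩ := List.append_of_mem ((hm y v).2 h)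
  rw [portOf_append (hn y) e] at hy
  obtain rfl : pre = [] := List.length_eq_zero_iff.1 (by omega)
  exact ⟨suf, e⟩

theorem exists_eq_cons_cons_of_portOf_eq_two (hn : ∀ v, (ord v).Nodup)
    (hm : ∀ v w, w ∈ ord v ↔ G.Adj v w) {v y : V} (h : G.Adj y v) (hy : portOf ord y v = 2) :
    ∃ u l, ord y = u :: v :: l := by
  obtain ⟨pre, suf, e⟩ := List.append_of_mem ((hm y v).2 h)
  rw [portOf_append (hn y) e] at hy
  obtain ⟨u, rfl⟩ := List.length_eq_one_iff.1 (show pre.length = 1 by omega)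
  exact ⟨u, suf, e⟩

/-- A visit of `y` through its first port, when the second port leads to a vertex that rejects. -/
theorem run_down_one_conflict (hn : ∀ v, (ord v).Nodup) (hm : ∀ v w, w ∈ ord v ↔ G.Adj v w)
    {v y w : V} (h : G.Adj v y) (hy : portOf ord y v = 1) (hyw : G.Adj y w)
    (hw : portOf ord y w = 2) (hq : 3 ≤ portOf ord w y) :
    Run G (portOf ord) (down, y, portOf ord y v) (up, v, portOf ord v y) 3 {y} := by
  obtain ⟨u, l, e⟩ := exists_eq_cons_cons_of_portOf_eq_two hn hm hyw hw
  obtain ⟨l', e'⟩ := exists_eq_cons_of_portOf_eq_one hn hm h.symm hy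
  obtain rfl : u = v := by simp_all
  have h1 : Run G (portOf ord) (down, y, portOf ord y u) (down, w, portOf ord w y) 1 {y} :=
    Run.single (agentStep_portOf (pre := [u]) hn hm e (by simp [agent, hy, e]))
  exact ((h1.trans (run_down_reject hn hm hyw hq)).trans
    (run_exit hn hm e (Or.inl rfl))).mono (by simp)

/-- Successive visits of a list of neighbors, each of which reports back in state `up`. -/
theorem run_children (hn : ∀ v, (ord v).Nodup) (hm : ∀ v w, w ∈ ord v ↔ G.Adj v w)
    {v : V} (S : V → Set V) (W : V → ℕ) (l : List V) : ∀ (pre suf : List V),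
    ord v = pre ++ (l ++ suf) →
    (∀ y ∈ l, ∃ k, k + 1 ≤ W y ∧
      Run G (portOf ord) (down, y, portOf ord y v) (up, v, portOf ord v y) k (S y)) →
    ∃ k, k ≤ (l.map W).sum ∧
      Run G (portOf ord) (up, v, pre.length) (up, v, (pre ++ l).length) k (⋃ y ∈ l, S y) := by
  induction l with
  | nil => exact fun pre suf _ _ => ⟨0, by simp, by simpa using Run.refl _⟩
  | cons y l ih =>
    intro pre suf h hr
    obtain ⟨k, hk, hk'⟩ := hr y (by simp)
    obtain ⟨m, hm1, hm2⟩ := ih (pre ++ [y]) suf (by simp [h]) fun z hz => hr z (by simp [hz])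
    have h1 := run_enter_down hn hm (v := v) (y := y) (pre := pre) (suf := l ++ suf) (by simp [h])
    have e : portOf ord v y = (pre ++ [y]).length := by
      rw [portOf_append (hn v) (pre := pre) (suf := l ++ suf) (by simp [h])]
      simp
    rw [e] at hk'
    refine ⟨1 + k + m, by simp only [List.map_cons, List.sum_cons]; omega, ?_⟩
    have := (h1.trans hk').trans hm2
    rw [List.append_assoc, List.singleton_append] at this
    refine this.mono ?_
    simp only [List.mem_cons, Set.iUnion_iUnion_eq_or_left]
    intro z hz
    rcases hz with hz | hz
    · exact Or.inl (Or.inr hz)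
    · exact Or.inr hz

/-- Successive visits, in state `probe`, of neighbors that are entered through their first port. -/
theorem run_probes (hn : ∀ v, (ord v).Nodup) (hm : ∀ v w, w ∈ ord v ↔ G.Adj v w)
    {v : V} (l : List V) : ∀ (pre suf : List V),
    ord v = pre ++ (l ++ suf) → (∀ y ∈ l, portOf ord y v = 1) →
      Run G (portOf ord) (upLeaf, v, pre.length) (upLeaf, v, (pre ++ l).length) (2 * l.length)
        {y | y ∈ l} := by
  induction l with
  | nil => exact fun pre suf _ _ => by simpa using Run.refl _
  | cons y l ih =>
    intro pre suf h hr
    have hvy : G.Adj v y := (hm v y).1 (by simp [h])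
    have h0 := ih (pre ++ [y]) suf (by simp [h]) fun z hz => hr z (by simp [hz])
    have h1 := run_enter_probe hn hm (v := v) (y := y) (pre := pre) (suf := l ++ suf) (by simp [h])
    have e : portOf ord v y = (pre ++ [y]).length := by
      rw [portOf_append (hn v) (pre := pre) (suf := l ++ suf) (by simp [h])]
      simp
    have h2 := run_probe_one hn hm hvy (hr y (by simp))
    rw [e] at h2
    have := (h1.trans h2).trans h0
    rw [List.append_assoc, List.singleton_append,
      show 1 + 1 + 2 * l.length = 2 * (y :: l).length by simp; ring] at this
    refine this.mono ?_
    rintro z hz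
    rcases List.mem_cons.1 hz with rfl | hz
    · exact Or.inl (Or.inr rfl)
    · exact Or.inr hz

/-- Probing a list of neighbors entered through port one or two, up to the end of the order. -/
theorem run_probes_exit (hn : ∀ v, (ord v).Nodup) (hm : ∀ v w, w ∈ ord v ↔ G.Adj v w)
    {v p : V} {q : List V} (hp : ord v = p :: q) (l : List V) : ∀ (pre : List V),
    ord v = pre ++ l → ∃ k ≤ 2 * l.length + 1,
      Run G (portOf ord) (upLeaf, v, pre.length) (up, p, portOf ord p v) k {v} := by
  induction l with
  | nil => exact fun pre h => ⟨1, by simp, run_exit hn hm hp (Or.inr ⟨Or.inr rfl, by simp [h]⟩)⟩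
  | cons y l ih =>
    intro pre h
    have hvy : G.Adj v y := (hm v y).1 (by simp [h])
    have h1 := run_enter_probe hn hm (v := v) (y := y) (pre := pre) (suf := l) h
    have e : portOf ord v y = (pre ++ [y]).length := by
      rw [portOf_append (hn v) h]
      simp
    by_cases hy : portOf ord y v = 1
    · obtain ⟨k, hk, hk'⟩ := ih (pre ++ [y]) (by simp [h])
      have h2 := run_probe_one hn hm hvy hy
      rw [e] at h2
      refine ⟨1 + 1 + k, by simp only [List.length_cons]; omega, ((h1.trans h2).trans hk').mono ?_⟩
      simp
    · have h2 := run_probe_reject hn hm hvy (by have : 1 ≤ portOf ord y v := by simp [portOf]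
                                                omega)
      refine ⟨1 + 1 + 1, by simp only [List.length_cons]; omega,
        ((h1.trans h2).trans (run_exit hn hm hp (Or.inl rfl))).mono ?_⟩
      simp

end Visits

section Leaves

variable {V : Type*} [DecidableEq V] {G : SimpleGraph V} {ord : V → List V}

/-- What the agent needs to know about the last part `B ++ N` of the order at `v`, in order to visit
`B` and to return to the first neighbor of `v` with at most `2 * c + 1` additional steps. -/
structure GoodEnd (ord : V → List V) (G : SimpleGraph V) (v : V) (B N : List V) (c : ℕ) : Prop where
  head : ∀ x t, B = x :: t → portOf ord x v = 2
  last : ∀ x m y, B = x :: (m ++ [y]) → portOf ord y v = 2 ∧ ∀ z ∈ m, portOf ord z v = 1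
  rest : 2 ≤ B.length ∨ (∃ y N', N = y :: N' ∧ 3 ≤ portOf ord y v ∧ 1 ≤ c) ∨
    (B.length = 1 ∧ N.length ≤ c) ∨ (B = [] ∧ N = []) ∨
    (B = [] ∧ ∃ y, N = [y] ∧ 2 ≤ c ∧ (portOf ord y v = 2 ∨ (portOf ord y v = 1 ∧
      ∃ w, G.Adj y w ∧ portOf ord y w = 2 ∧ 3 ≤ portOf ord w y)))

theorem run_goodEnd (hn : ∀ v, (ord v).Nodup) (hm : ∀ v w, w ∈ ord v ↔ G.Adj v w)
    {v p : V} {q pre B N : List V} {c : ℕ} (hp : ord v = p :: q) (h : ord v = pre ++ (B ++ N))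
    (hg : GoodEnd ord G v B N c) : ∃ k ≤ 2 * B.length + 2 * c + 1,
      Run G (portOf ord) (up, v, pre.length) (up, p, portOf ord p v) k ({v} ∪ {y | y ∈ B}) := by
  rcases B with _ | ⟨x, t⟩
  · simp only [List.nil_append] at h
    rcases hg.rest with hr | ⟨y, N', rfl, hy, hc⟩ | ⟨hr, -⟩ | ⟨-, rfl⟩ | ⟨-, y, rfl, hc, hy⟩
    · simp at hr
    · have hvy : G.Adj v y := (hm v y).1 (by simp [h])
      exact ⟨1 + 1 + 1, by omega, (((run_enter_down hn hm h).trans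
        (run_down_reject hn hm hvy hy)).trans (run_exit hn hm hp (Or.inl rfl))).mono (by simp)⟩
    · simp at hr
    · exact ⟨1, by omega, (run_exit hn hm hp (Or.inr ⟨Or.inl rfl, by simp [h]⟩)).mono (by simp)⟩
    · have hvy : G.Adj v y := (hm v y).1 (by simp [h])
      have e : portOf ord v y = (ord v).length := by
        rw [portOf_append (hn v) h]
        simp [h]
      rcases hy with hy | ⟨hy, w, hyw, hw, hq⟩
      · exact ⟨1 + 1 + 1, by omega, (((run_enter_down hn hm h).trans
          (run_down_two hn hm hvy hy)).trans
            (run_exit hn hm hp (Or.inr ⟨Or.inr rfl, e⟩))).mono (by simp)⟩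
      · exact ⟨1 + 3 + 1, by omega, (((run_enter_down hn hm h).trans
          (run_down_one_conflict hn hm hvy hy hyw hw hq)).trans
            (run_exit hn hm hp (Or.inr ⟨Or.inl rfl, e⟩))).mono (by simp)⟩
  · have hvx : G.Adj v x := (hm v x).1 (by simp [h])
    have ex : portOf ord v x = (pre ++ [x]).length := by
      rw [portOf_append (hn v) (pre := pre) (suf := t ++ N) (by simp [h])]
      simp
    have h1 := (run_enter_down hn hm (v := v) (y := x) (pre := pre) (suf := t ++ N)
      (by simp [h])).trans (run_down_two hn hm hvx (hg.head x t rfl))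
    rw [ex] at h1
    rcases List.eq_nil_or_concat' t with rfl | ⟨m, y, rfl⟩
    · rcases hg.rest with hr | ⟨y, N', rfl, hy, hc⟩ | ⟨-, hr⟩ | ⟨hr, -⟩ | ⟨hr, -⟩
      · simp at hr
      · have hvy : G.Adj v y := (hm v y).1 (by simp [h])
        have h2 := (run_enter_probe hn hm (v := v) (y := y) (pre := pre ++ [x]) (suf := N')
          (by simp [h])).trans (run_probe_reject hn hm hvy (by omega))
        refine ⟨_, ?_, ((h1.trans h2).trans (run_exit hn hm hp (Or.inl rfl))).mono ?_⟩
        · simp only [List.length_singleton]; omega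
        · intro z hz; simp at hz ⊢; tauto
      · obtain ⟨k, hk, hk'⟩ := run_probes_exit hn hm hp N (pre ++ [x]) (by simp [h])
        refine ⟨_, ?_, (h1.trans hk').mono ?_⟩
        · simp only [List.length_singleton]; omega
        · intro z hz; simp at hz ⊢; tauto
      · simp at hr
      · simp at hr
    · have hvy : G.Adj v y := (hm v y).1 (by simp [h])
      obtain ⟨hy, hz⟩ := hg.last x m y rfl
      have h2 := run_probes hn hm m (pre ++ [x]) ([y] ++ N) (by simp [h]) hz
      have h3 := (run_enter_probe hn hm (v := v) (y := y) (pre := pre ++ [x] ++ m) (suf := N)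
          (by simp [h])).trans (run_probe_reject hn hm hvy (by omega))
      refine ⟨_, ?_, (((h1.trans h2).trans h3).trans (run_exit hn hm hp (Or.inl rfl))).mono ?_⟩
      · simp; omega
      · intro z hz; simp at hz ⊢; tauto

end Leaves

section Tour

variable {V : Type*} [DecidableEq V]

/-- A rooted spanning tree of `G` with inner vertices `I`, a root edge `r r'` and an order of the
neighbors of every vertex that steers the agent along the tree. -/
structure Layout (G : SimpleGraph V) where
  /-- the inner vertices -/
  I : Finset V
  /-- the order of the neighbors -/
  ord : V → List V
  /-- the parent -/
  par : V → V
  /-- the distance to the root edge -/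
  rk : V → ℕ
  /-- one end of the root edge -/
  r : V
  /-- the other end of the root edge -/
  r' : V
  /-- the children that are inner vertices or pendant -/
  A : V → List V
  /-- the other children -/
  B : V → List V
  /-- the neighbors that are not joined by tree edges -/
  N : V → List V
  /-- half of the number of steps spent on non-tree edges -/
  cost : V → ℕ
  nodup : ∀ v, (ord v).Nodup
  mem_ord : ∀ v w, w ∈ ord v ↔ G.Adj v w
  ord_eq : ∀ v ∈ I, ord v = par v :: (A v ++ (B v ++ N v))
  ne_nil : ∀ v ∈ I, A v ++ B v ≠ []
  mem_child : ∀ v ∈ I, ∀ y, y ∈ A v ++ B v ↔ par y = v ∧ 1 ≤ rk y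
  rk_par : ∀ v, 1 ≤ rk v → rk v = rk (par v) + 1 ∧ par v ∈ I
  root : ∀ v, rk v = 0 → v = r ∨ v = r'
  root_ne : r ≠ r'
  par_r : par r = r'
  par_r' : par r' = r
  rk_r : rk r = 0
  rk_r' : rk r' = 0
  r_mem : r ∈ I
  r'_mem : r' ∈ I
  A_mem : ∀ v ∈ I, ∀ y ∈ A v, y ∈ I ∨ (y ∉ I ∧ ord y = [v])
  B_mem : ∀ v ∈ I, ∀ y ∈ B v, y ∉ I
  cost_eq : ∀ v, v ∉ I → cost v = 0
  goodEnd : ∀ v ∈ I, GoodEnd ord G v (B v) (N v) (cost v)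

namespace Layout

variable {G : SimpleGraph V} (T : Layout G)

theorem rk_iterate (j : ℕ) (w : V) (h : j ≤ T.rk w) : T.rk (T.par^[j] w) = T.rk w - j := by
  induction j with
  | zero => simp
  | succ j ih =>
    rw [Function.iterate_succ_apply']
    have h1 := ih (by omega)
    have := T.rk_par (T.par^[j] w) (by omega)
    omega

theorem rk_child {v y : V} (hv : v ∈ T.I) (hy : y ∈ T.A v ++ T.B v) : T.rk y = T.rk v + 1 := by
  obtain ⟨rfl, h⟩ := (T.mem_child v hv y).1 hy
  exact (T.rk_par y h).1

theorem nodup_children {v : V} (hv : v ∈ T.I) : (T.A v ++ T.B v).Nodup := by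
  have := T.nodup v
  rw [T.ord_eq v hv, ← List.append_assoc] at this
  exact (List.nodup_append.1 (List.nodup_cons.1 this).2).1

theorem adj_of_mem_child {v y : V} (hv : v ∈ T.I) (hy : y ∈ T.A v ++ T.B v) : G.Adj v y := by
  rw [← T.mem_ord, T.ord_eq v hv]
  simp only [List.mem_append] at hy
  simp only [List.mem_cons, List.mem_append]
  tauto

variable [Fintype V]

/-- The descendants of a vertex. -/
def desc (v : V) : Finset V :=
  Finset.univ.filter fun w => T.rk v ≤ T.rk w ∧ T.par^[T.rk w - T.rk v] w = v

theorem mem_desc {v w : V} : w ∈ T.desc v ↔ T.rk v ≤ T.rk w ∧ T.par^[T.rk w - T.rk v] w = v := by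
  simp [desc]

theorem self_mem_desc (v : V) : v ∈ T.desc v := by simp [mem_desc]

theorem disjoint_desc {v w : V} (h : T.rk v = T.rk w) (hvw : v ≠ w) :
    Disjoint (T.desc v) (T.desc w) := by
  rw [Finset.disjoint_left]
  intro x hx hx'
  rw [mem_desc] at hx hx'
  rw [← h] at hx'
  exact hvw (hx.2.symm.trans hx'.2)

theorem exists_child_of_mem_desc {v w : V} (h : w ∈ T.desc v) (hw : w ≠ v) :
    v ∈ T.I ∧ ∃ y ∈ T.A v ++ T.B v, w ∈ T.desc y := by
  rw [mem_desc] at h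
  obtain ⟨h1, h2⟩ := h
  rcases h1.eq_or_lt with h1 | h1
  · exact absurd (by simpa [h1] using h2) hw
  · obtain ⟨j, hj⟩ : ∃ j, T.rk w - T.rk v = j + 1 := ⟨T.rk w - T.rk v - 1, by omega⟩
    rw [hj, Function.iterate_succ_apply'] at h2
    have h3 := T.rk_iterate j w (by omega)
    have h4 := T.rk_par (T.par^[j] w) (by omega)
    rw [h2] at h4
    refine ⟨h4.2, T.par^[j] w, (T.mem_child v h4.2 _).2 ⟨h2, by omega⟩, ?_⟩
    rw [mem_desc, h3]
    refine ⟨by omega, ?_⟩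
    rw [show T.rk w - (T.rk w - j) = j by omega]

theorem desc_of_notMem {v : V} (hv : v ∉ T.I) : T.desc v = {v} := by
  ext w
  rw [Finset.mem_singleton]
  refine ⟨fun h => ?_, fun h => h ▸ T.self_mem_desc v⟩
  by_contra hw
  exact hv (T.exists_child_of_mem_desc h hw).1

theorem desc_eq {v : V} (hv : v ∈ T.I) :
    T.desc v = {v} ∪ (T.A v ++ T.B v).toFinset.biUnion T.desc := by
  ext w
  simp only [Finset.mem_union, Finset.mem_singleton, Finset.mem_biUnion, List.mem_toFinset]
  constructor
  · intro h
    by_cases hw : w = v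
    · exact Or.inl hw
    · exact Or.inr (T.exists_child_of_mem_desc h hw).2
  · rintro (rfl | ⟨y, hy, hw⟩)
    · exact T.self_mem_desc _
    · have h1 := T.rk_child hv hy
      rw [mem_desc] at hw ⊢
      refine ⟨by omega, ?_⟩
      rw [show T.rk w - T.rk v = T.rk w - T.rk y + 1 by omega, Function.iterate_succ_apply', hw.2]
      exact ((T.mem_child v hv y).1 hy).1

/-- The number of steps charged to a set of vertices. -/
def weight (s : Finset V) : ℕ := ∑ w ∈ s, (2 + 2 * T.cost w)

theorem weight_desc {v : V} (hv : v ∈ T.I) :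
    T.weight (T.desc v) = 2 + 2 * T.cost v +
      (((T.A v).map fun y => T.weight (T.desc y)).sum +
        ((T.B v).map fun y => T.weight (T.desc y)).sum) := by
  have hd : Disjoint {v} ((T.A v ++ T.B v).toFinset.biUnion T.desc) := by
    rw [Finset.disjoint_singleton_left]
    simp only [Finset.mem_biUnion, List.mem_toFinset, not_exists, not_and]
    intro y hy h
    have := T.rk_child hv hy
    have := (T.mem_desc.1 h).1
    omega
  rw [← List.sum_append, ← List.map_append, ← List.sum_toFinset _ (T.nodup_children hv), weight,
    T.desc_eq hv, Finset.sum_union hd, Finset.sum_singleton, Finset.sum_biUnion]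
  · rfl
  · intro y hy z hz hyz
    simp only [List.coe_toFinset, Set.mem_ofPred_eq] at hy hz
    exact T.disjoint_desc ((T.rk_child hv hy).trans (T.rk_child hv hz).symm) hyz

theorem weight_desc_leaf {y : V} (hy : y ∉ T.I) : T.weight (T.desc y) = 2 := by
  simp [T.desc_of_notMem hy, weight, T.cost_eq y hy]

/-- Entering an inner vertex from its parent, the agent visits all descendants and returns. -/
theorem exists_run_desc (M : ℕ) : ∀ v ∈ T.I, (∀ w, T.rk w < T.rk v + M) →
    ∃ k, k + 1 ≤ T.weight (T.desc v) ∧ Run G (portOf T.ord) (down, v, 1)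
      (up, T.par v, portOf T.ord (T.par v) v) k (T.desc v) ∧ 0 < k := by
  induction M with
  | zero => exact fun v _ h => absurd (h v) (by omega)
  | succ M ih =>
    intro v hv hM
    have hA : ∀ y ∈ T.A v, ∃ k, k + 1 ≤ T.weight (T.desc y) ∧
        Run G (portOf T.ord) (down, y, portOf T.ord y v) (up, v, portOf T.ord v y) k
          (T.desc y) := by
      intro y hy
      have hy' : y ∈ T.A v ++ T.B v := List.mem_append_left _ hy
      have hp := ((T.mem_child v hv y).1 hy').1
      rcases T.A_mem v hv y hy with h | ⟨h, e⟩
      · obtain ⟨k, hk, hk', -⟩ := ih y h fun w => by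
          have := hM w
          have := T.rk_child hv hy'
          omega
        rw [hp] at hk'
        refine ⟨k, hk, ?_⟩
        rwa [portOf_append (pre := []) (T.nodup y) (by rw [T.ord_eq y h, hp]; rfl)]
      · refine ⟨1, by rw [T.weight_desc_leaf h], ?_⟩
        rw [T.desc_of_notMem h]
        simpa using run_down_pendant T.nodup T.mem_ord (T.adj_of_mem_child hv hy') e
    have e := T.ord_eq v hv
    obtain ⟨k, hk, hk'⟩ := run_children T.nodup T.mem_ord (fun y => (T.desc y : Set V))
      (fun y => T.weight (T.desc y)) (T.A v) [T.par v] (T.B v ++ T.N v) e hA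
    obtain ⟨m, hm, hm'⟩ := run_goodEnd T.nodup T.mem_ord e
      (pre := [T.par v] ++ T.A v) (by simp [e]) (T.goodEnd v hv)
    have hB : ((T.B v).map fun y => T.weight (T.desc y)).sum = 2 * (T.B v).length := by
      rw [List.map_congr_left (g := fun _ => 2) fun y hy => T.weight_desc_leaf (T.B_mem v hv y hy)]
      simp [mul_comm]
    have hm0 : 0 < m := by
      rcases Nat.eq_zero_or_pos m with rfl | h
      · obtain ⟨t, -, -, -, ht⟩ := hm'
        obtain ⟨i, hi, -⟩ := ht v (by simp)
        omega
      · exact h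
    refine ⟨k + m, by rw [T.weight_desc hv, hB]; omega, ?_, by omega⟩
    refine ((hk'.trans hm').congr_start (s' := down) (i' := 1) (by omega) ?_).mono ?_
    · have h2 : 2 ≤ portDeg G v := by
        rw [portDeg_eq_length (T.nodup v) (T.mem_ord v), e, ← List.append_assoc]
        have := List.length_pos_of_ne_nil (T.ne_nil v hv)
        simp only [List.length_cons, List.length_append] at this ⊢
        omega
      simp [agent, show portDeg G v ≠ 1 by omega, show 1 < portDeg G v by omega]
    · rw [T.desc_eq hv]
      intro w hw
      simp only [Finset.coe_union, Finset.coe_singleton, Finset.coe_biUnion, Set.mem_union,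
        Set.mem_singleton_iff, Set.mem_iUnion, List.coe_toFinset, Set.mem_ofPred_eq,
        List.mem_append, Finset.mem_coe] at hw ⊢
      rcases hw with hw | ⟨y, hy | hy, hw⟩
      · exact Or.inr (Or.inl hw)
      · exact Or.inl ⟨y, hy, hw⟩
      · rw [T.desc_of_notMem (T.B_mem v hv y hy), Finset.mem_singleton] at hw
        exact Or.inr (Or.inr (hw ▸ hy))

theorem exists_run : ∃ k, k + 2 ≤ T.weight Finset.univ ∧
    Run G (portOf T.ord) (up, T.r, 1) (up, T.r, 1) k Set.univ ∧ 0 < k := by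
  have hM : ∀ v w, T.rk w < T.rk v + (∑ w, T.rk w + 1) := fun v w => by
    have := Finset.single_le_sum (f := T.rk) (fun _ _ => Nat.zero_le _) (Finset.mem_univ w)
    omega
  obtain ⟨k, hk, hk', k0⟩ := T.exists_run_desc _ T.r T.r_mem (hM _)
  obtain ⟨m, hm, hm', m0⟩ := T.exists_run_desc _ T.r' T.r'_mem (hM _)
  have two : ∀ v ∈ T.I, 2 ≤ portDeg G v := fun v hv => by
    rw [portDeg_eq_length (T.nodup v) (T.mem_ord v), T.ord_eq v hv, ← List.append_assoc]
    have := List.length_pos_of_ne_nil (T.ne_nil v hv)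
    simp only [List.length_cons, List.length_append] at this ⊢
    omega
  have agree : ∀ v ∈ T.I, agent (up, 1, portDeg G v) = agent (down, 1, portDeg G v) :=
    fun v hv => by
      have := two v hv
      simp [agent, show portDeg G v ≠ 1 by omega, show 1 < portDeg G v by omega]
  have e1 : portOf T.ord T.r' T.r = 1 :=
    portOf_append (pre := []) (T.nodup _) (by rw [T.ord_eq _ T.r'_mem, T.par_r']; rfl)
  have e2 : portOf T.ord T.r T.r' = 1 :=
    portOf_append (pre := []) (T.nodup _) (by rw [T.ord_eq _ T.r_mem, T.par_r]; rfl)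
  rw [T.par_r, e1] at hk'
  rw [T.par_r', e2] at hm'
  have hu : (Finset.univ : Finset V) = T.desc T.r ∪ T.desc T.r' := by
    refine (Finset.eq_univ_of_forall fun w => ?_).symm
    have h1 := T.rk_iterate (T.rk w) w le_rfl
    rw [Nat.sub_self] at h1
    simp only [Finset.mem_union, mem_desc, T.rk_r, T.rk_r', Nat.zero_le, true_and, Nat.sub_zero]
    exact T.root _ h1
  refine ⟨k + m, ?_, ?_, by omega⟩
  · rw [hu, weight, Finset.sum_union (T.disjoint_desc (T.rk_r.trans T.rk_r'.symm) T.root_ne)]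
    unfold weight at hk hm
    omega
  · refine ((hk'.congr_start k0 (agree _ T.r_mem)).trans
      (hm'.congr_start m0 (agree _ T.r'_mem))).mono ?_
    rw [← Finset.coe_union, ← hu, Finset.coe_univ]

end Layout

end Tour

section Orientation

variable {ι W : Type*} [DecidableEq ι] [DecidableEq W]

/-- The signed incidence of an arc with head `x` and tail `y`. -/
def arc (x y w : W) : ℤ := (if x = w then 1 else 0) - if y = w then 1 else 0

theorem arc_swap (x y w : W) : arc y x w = -1 * arc x y w := by
  unfold arc; ring

theorem abs_arc_le (x y w : W) : |arc x y w| ≤ 1 := by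
  unfold arc; split_ifs <;> simp

theorem exists_sign_arc {x y v : W} (h : arc x y v ≠ 0) :
    (∃ z, ∃ ε : ℤ, (ε = 1 ∨ ε = -1) ∧ ∀ w, ε * arc x y w = arc z v w) := by
  by_cases h1 : y = v
  · exact ⟨x, 1, by simp, fun w => by rw [h1]; simp⟩
  · by_cases h2 : x = v
    · exact ⟨y, -1, by simp, fun w => by rw [h2, arc_swap v y]⟩
    · simp [arc, h1, h2] at h

/-- Every multigraph has an orientation in which in- and outdegrees differ by at most one. -/
theorem exists_balanced_sign (n : ℕ) : ∀ (E : Finset ι) (D : ι → W → ℤ), E.card = n →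
    (∀ e ∈ E, ∃ x y, ∀ w, D e w = arc x y w) →
    ∃ σ : ι → ℤ, (∀ e, σ e = 1 ∨ σ e = -1) ∧ ∀ w, |∑ e ∈ E, σ e * D e w| ≤ 1 := by
  induction n with
  | zero =>
    intro E D hE _
    obtain rfl := Finset.card_eq_zero.1 hE
    exact ⟨fun _ => 1, by simp, by simp⟩
  | succ n ih =>
    intro E D hE hD
    by_cases hs : ∃ e ∈ E, ∃ f ∈ E, e ≠ f ∧ ∃ v, D e v ≠ 0 ∧ D f v ≠ 0
    · obtain ⟨e, he, f, hf, hef, v, hev, hfv⟩ := hs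
      obtain ⟨x, y, hxy⟩ := hD e he
      obtain ⟨x', y', hxy'⟩ := hD f hf
      obtain ⟨z, ε, hε, hz⟩ := exists_sign_arc (hxy v ▸ hev)
      obtain ⟨z', ε', hε', hz'⟩ := exists_sign_arc (hxy' v ▸ hfv)
      obtain ⟨σ, hσ, hσ'⟩ := ih (E.erase f) (fun g => if g = e then arc z z' else D g)
        (by rw [Finset.card_erase_of_mem hf]; omega) fun g hg => by
          by_cases h : g = e
          · exact ⟨z, z', by simp [h]⟩
          · simpa [h] using hD g (Finset.mem_of_mem_erase hg)
      refine ⟨fun g => if g = f then -(σ e * ε') else if g = e then σ e * ε else σ g, ?_, ?_⟩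
      · intro g
        dsimp only
        split_ifs
        · rcases hσ e with h1 | h1 <;> rcases hε' with h2 | h2 <;> simp [h1, h2]
        · rcases hσ e with h1 | h1 <;> rcases hε with h2 | h2 <;> simp [h1, h2]
        · exact hσ g
      · intro w
        have he' : e ∈ E.erase f := Finset.mem_erase.2 ⟨hef, he⟩
        convert hσ' w using 2
        rw [← Finset.add_sum_erase _ _ hf, ← Finset.add_sum_erase _ _ he',
          ← Finset.add_sum_erase _ _ he', ← add_assoc]
        congr 1
        · have h1 := hz w
          have h2 := hz' w
          simp only [if_true, if_neg hef, hxy, hxy']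
          have h3 : arc z z' w = ε * arc x y w - ε' * arc x' y' w := by
            rw [h1, h2]; unfold arc; ring
          rw [h3]; ring
        · refine Finset.sum_congr rfl fun g hg => ?_
          obtain ⟨h1, h2⟩ := Finset.mem_erase.1 hg
          have h3 := (Finset.mem_erase.1 h2).1
          simp [h1, h3]
    · push Not at hs
      refine ⟨fun _ => 1, by simp, fun w => ?_⟩
      by_cases h : ∃ e ∈ E, D e w ≠ 0
      · obtain ⟨e, he, hew⟩ := h
        rw [Finset.sum_eq_single e (fun f hf hfe => by simp [hs e he f hf hfe.symm w hew])
          fun h => absurd he h]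
        obtain ⟨x, y, hxy⟩ := hD e he
        simpa [hxy] using abs_arc_le x y w
      · push Not at h
        rw [Finset.sum_eq_zero fun e he => by simp [h e he]]
        simp

/-- Orientation of edges with ends `a`, `b` that is balanced on the vertices satisfying `p`, and in
total does not leave the set of these vertices. -/
theorem exists_orientation {V : Type*} [DecidableEq V] [Fintype V] (E : Finset ι) (a b : ι → V)
    (p : V → Prop) [DecidablePred p] : ∃ h t : ι → V,
      (∀ e, (h e = a e ∧ t e = b e) ∨ (h e = b e ∧ t e = a e)) ∧
      (∀ v, p v → |((E.filter fun e => h e = v).card : ℤ) - (E.filter fun e => t e = v).card| ≤ 1) ∧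
      0 ≤ ∑ v with p v, (((E.filter fun e => h e = v).card : ℤ) -
        (E.filter fun e => t e = v).card) := by
  let κ : V → Option V := fun v => if p v then some v else none
  obtain ⟨σ, hσ, hσ'⟩ : ∃ σ : ι → ℤ, (∀ e, σ e = 1 ∨ σ e = -1) ∧
      (∀ w, |∑ e ∈ E, σ e * arc (κ (a e)) (κ (b e)) w| ≤ 1) ∧
      ∑ e ∈ E, σ e * arc (κ (a e)) (κ (b e)) none ≤ 0 := by
    obtain ⟨σ, hσ, hσ'⟩ := exists_balanced_sign E.card E (fun e => arc (κ (a e)) (κ (b e))) rfl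
      fun e _ => ⟨_, _, fun _ => rfl⟩
    rcases le_total (∑ e ∈ E, σ e * arc (κ (a e)) (κ (b e)) none) 0 with h | h
    · exact ⟨σ, hσ, hσ', h⟩
    · refine ⟨fun e => -σ e, fun e => ?_, fun w => ?_, ?_⟩
      · rcases hσ e with h | h <;> simp [h]
      · simpa [Finset.sum_neg_distrib] using hσ' w
      · simpa [Finset.sum_neg_distrib] using h
  let h : ι → V := fun e => if σ e = 1 then a e else b e
  let t : ι → V := fun e => if σ e = 1 then b e else a e
  have hht : ∀ e, (h e = a e ∧ t e = b e) ∨ (h e = b e ∧ t e = a e) := fun e => by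
    by_cases he : σ e = 1 <;> simp [h, t, he]
  have key : ∀ w, ∑ e ∈ E, σ e * arc (κ (a e)) (κ (b e)) w =
      ∑ e ∈ E, arc (κ (h e)) (κ (t e)) w := fun w => Finset.sum_congr rfl fun e _ => by
    rcases hσ e with he | he
    · simp [h, t, he]
    · simp only [h, t, he]
      rw [arc_swap (κ (b e))]
      simp
  simp only [key] at hσ'
  have hsome : ∀ v, p v → ∑ e ∈ E, arc (κ (h e)) (κ (t e)) (some v) =
      ((E.filter fun e => h e = v).card : ℤ) - (E.filter fun e => t e = v).card := fun v hv => by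
    have hk : ∀ u, κ u = some v ↔ u = v := fun u => by
      by_cases hu : p u
      · simp [κ, hu]
      · simp only [κ, hu, if_false, reduceCtorEq, false_iff]
        rintro rfl
        exact hu hv
    simp only [arc, hk, Finset.sum_sub_distrib, Finset.sum_boole]
  refine ⟨h, t, hht, fun v hv => hsome v hv ▸ hσ'.1 _, ?_⟩
  rw [Finset.sum_congr rfl fun v hv => (hsome v (Finset.mem_filter.1 hv).2).symm]
  have htot : ∑ w : Option V, ∑ e ∈ E, arc (κ (h e)) (κ (t e)) w = 0 := by
    rw [Finset.sum_comm]
    refine Finset.sum_eq_zero fun e _ => ?_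
    simp [arc, Finset.sum_sub_distrib]
  rw [Fintype.sum_option] at htot
  have hz : ∑ v with p v, ∑ e ∈ E, arc (κ (h e)) (κ (t e)) (some v) =
      ∑ v, ∑ e ∈ E, arc (κ (h e)) (κ (t e)) (some v) := by
    refine Finset.sum_subset (Finset.filter_subset _ _) fun v _ hv => ?_
    have hv' : ¬ p v := by simpa using hv
    have hk : ∀ u, κ u ≠ some v := fun u hu => by
      by_cases h' : p u
      · simp only [κ, h', if_true, Option.some.injEq] at hu
        exact hv' (hu ▸ h')
      · simp [κ, h'] at hu
    simp [arc, hk]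
  rw [hz]
  linarith [hσ'.2]

end Orientation

section Greedy

variable {V : Type*} [DecidableEq V] [Fintype V] (G : SimpleGraph V) [DecidableRel G.Adj]

omit [DecidableEq V] [Fintype V] [DecidableRel G.Adj] in
/-- The edges of `G` inside `I`. -/
def innerGraph (I : Finset V) : SimpleGraph V where
  Adj x y := G.Adj x y ∧ x ∈ I ∧ y ∈ I
  symm := ⟨fun _ _ h => ⟨h.1.symm, h.2.2, h.2.1⟩⟩
  loopless := ⟨fun _ h => G.loopless.irrefl _ h.1⟩

/-- The set `I` induces a connected subgraph. -/
def InnerConnected (I : Finset V) : Prop :=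
  ∀ x ∈ I, ∀ y ∈ I, (innerGraph G I).Reachable x y

/-- The closed neighborhood of `I`. -/
def closedNbhd (I : Finset V) : Finset V := Finset.univ.filter fun x => x ∈ I ∨ ∃ u ∈ I, G.Adj u x

/-- The neighbors of `x` outside the closed neighborhood of `I`. -/
def outer (I : Finset V) (x : V) : Finset V :=
  Finset.univ.filter fun y => G.Adj x y ∧ y ∉ closedNbhd G I

/-- The neighbors of `I` all of whose neighbors are in the closed neighborhood of `I`. -/
def dead (I : Finset V) : Finset V := (closedNbhd G I \ I).filter fun x => outer G I x = ∅

/-- The vertices of `I` of degree two. -/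
def degTwo (I : Finset V) : Finset V := I.filter fun x => G.degree x = 2

/-- The potential of the greedy construction of a connected dominating set. -/
def potential (I : Finset V) : ℤ :=
  2 * (closedNbhd G I).card - 3 * I.card + (degTwo G I).card + (dead G I).card

variable {G}

theorem mem_closedNbhd {I : Finset V} {x : V} :
    x ∈ closedNbhd G I ↔ x ∈ I ∨ ∃ u ∈ I, G.Adj u x := by
  simp [closedNbhd]

theorem mem_outer {I : Finset V} {x y : V} :
    y ∈ outer G I x ↔ G.Adj x y ∧ y ∉ closedNbhd G I := by
  simp [outer]

theorem mem_dead {I : Finset V} {x : V} :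
    x ∈ dead G I ↔ x ∈ closedNbhd G I ∧ x ∉ I ∧ outer G I x = ∅ := by
  simp [dead, and_assoc]

theorem closedNbhd_insert {I : Finset V} {v : V} (hv : v ∈ closedNbhd G I) :
    closedNbhd G (insert v I) = closedNbhd G I ∪ outer G I v := by
  ext x
  by_cases hx : x = v
  · subst hx
    simp only [Finset.mem_union, hv, true_or, iff_true]
    exact mem_closedNbhd.2 (Or.inl (Finset.mem_insert_self _ _))
  · rw [Finset.mem_union, mem_outer, mem_closedNbhd, mem_closedNbhd]
    simp only [Finset.mem_insert, hx, false_or, exists_eq_or_imp]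
    by_cases h1 : x ∈ I <;> by_cases h2 : G.Adj v x <;> by_cases h3 : ∃ u ∈ I, G.Adj u x <;>
      simp only [h1, h2, h3, or_true, or_false, not_false_eq_true, not_true,
        and_self, and_true, and_false]

theorem outer_insert {I : Finset V} {v x : V} (hv : v ∈ closedNbhd G I) :
    outer G (insert v I) x = outer G I x \ outer G I v := by
  ext y
  rw [Finset.mem_sdiff, mem_outer, closedNbhd_insert hv, Finset.mem_union, mem_outer, mem_outer]
  tauto

theorem dead_subset_insert {I : Finset V} {v : V} (hv : v ∈ closedNbhd G I)
    (ho : (outer G I v).Nonempty) : dead G I ⊆ dead G (insert v I) := by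
  intro x hx
  rw [mem_dead] at hx ⊢
  rw [closedNbhd_insert hv, outer_insert hv]
  refine ⟨Finset.mem_union_left _ hx.1, ?_, by simp [hx.2.2]⟩
  rw [Finset.mem_insert]
  rintro (rfl | h)
  · simp [hx.2.2] at ho
  · exact hx.2.1 h

theorem potential_insert {I : Finset V} {v : V} (hv : v ∈ closedNbhd G I) (hvI : v ∉ I) :
    potential G (insert v I) = potential G I + 2 * (outer G I v).card - 3 +
      (if G.degree v = 2 then 1 else 0) + ((dead G (insert v I)).card - (dead G I).card) := by
  have h1 : (closedNbhd G (insert v I)).card = (closedNbhd G I).card + (outer G I v).card := by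
    rw [closedNbhd_insert hv, Finset.card_union_of_disjoint]
    rw [Finset.disjoint_right]
    exact fun y hy => (mem_outer.1 hy).2
  have h2 : ((degTwo G (insert v I)).card : ℤ) =
      (degTwo G I).card + if G.degree v = 2 then 1 else 0 := by
    rw [degTwo, Finset.filter_insert]
    split_ifs with h
    · rw [Finset.card_insert_of_notMem (by simp [hvI])]
      simp [degTwo]
    · simp [degTwo]
  rw [potential, potential, h1, h2, Finset.card_insert_of_notMem hvI]
  push_cast
  ring

omit [Fintype V] [DecidableRel G.Adj] in
theorem InnerConnected.insert {I : Finset V} (h : InnerConnected G I) {v u : V} (hu : u ∈ I)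
    (huv : G.Adj u v) : InnerConnected G (insert v I) := by
  have hle : innerGraph G I ≤ innerGraph G (Insert.insert v I) := fun x y hxy =>
    ⟨hxy.1, Finset.mem_insert_of_mem hxy.2.1, Finset.mem_insert_of_mem hxy.2.2⟩
  have key : ∀ x ∈ Insert.insert v I, (innerGraph G (Insert.insert v I)).Reachable u x := by
    intro x hx
    rcases Finset.mem_insert.1 hx with rfl | hx
    · exact SimpleGraph.Adj.reachable
        ⟨huv, Finset.mem_insert_of_mem hu, Finset.mem_insert_self _ _⟩
    · exact (h u hu x hx).mono hle
  exact fun x hx y hy => (key x hx).symm.trans (key y hy)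

/-- The invariant of the greedy construction. -/
def GreedyInv (G : SimpleGraph V) [DecidableRel G.Adj] (I : Finset V) : Prop :=
  I.Nonempty ∧ InnerConnected G I ∧ (1 ≤ potential G I ∨ (0 ≤ potential G I ∧
    ∃ x ∈ closedNbhd G I, x ∉ I ∧ (outer G I x).Nonempty ∧ G.degree x = 2))

theorem InnerConnected.insert_of_mem_closedNbhd {I : Finset V} (h : InnerConnected G I) {v : V}
    (hv : v ∈ closedNbhd G I) (hvI : v ∉ I) : InnerConnected G (Insert.insert v I) := by
  obtain ⟨u, hu, huv⟩ := (mem_closedNbhd.1 hv).resolve_left hvI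
  exact h.insert hu huv

theorem GreedyInv.step {I : Finset V} (h : GreedyInv G I) {x : V} (hx : x ∈ closedNbhd G I)
    (hxI : x ∉ I) (hxo : (outer G I x).Nonempty) :
    ∃ J, GreedyInv G J ∧ I.card < J.card := by
  obtain ⟨hne, hc, hp⟩ := h
  by_cases hbig : ∃ v ∈ closedNbhd G I, v ∉ I ∧ 2 ≤ (outer G I v).card
  · obtain ⟨v, hv, hvI, hvo⟩ := hbig
    refine ⟨insert v I, ⟨Finset.insert_nonempty _ _, hc.insert_of_mem_closedNbhd hv hvI,
      Or.inl ?_⟩, by simp [hvI]⟩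
    have h1 := potential_insert hv hvI
    have h2 := Finset.card_le_card (dead_subset_insert hv (Finset.card_pos.1 (by omega)))
    have h3 : 0 ≤ potential G I := by
      rcases hp with hp | hp
      · omega
      · exact hp.1
    split_ifs at h1 <;> omega
  push Not at hbig
  obtain ⟨v, hv, hvI, hvo, hδ⟩ : ∃ v ∈ closedNbhd G I, v ∉ I ∧ (outer G I v).Nonempty ∧
      1 ≤ potential G I + if G.degree v = 2 then 1 else 0 := by
    rcases hp with hp | ⟨hp, v, hv, hvI, hvo, hd⟩
    · exact ⟨x, hx, hxI, hxo, by split_ifs <;> omega⟩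
    · exact ⟨v, hv, hvI, hvo, by rw [if_pos hd]; omega⟩
  obtain ⟨y, hy⟩ : ∃ y, outer G I v = {y} :=
    Finset.card_eq_one.1 (by have := hbig v hv hvI; have := Finset.card_pos.2 hvo; omega)
  have hvy : G.Adj v y ∧ y ∉ closedNbhd G I := mem_outer.1 (by simp [hy])
  have h1 := potential_insert hv hvI
  rw [hy, Finset.card_singleton] at h1
  have hsub := dead_subset_insert hv hvo
  have h2 := Finset.card_le_card hsub
  have hc' := hc.insert_of_mem_closedNbhd hv hvI
  have hcard : (insert v I).card = I.card + 1 := by simp [hvI]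
  have hy1 : y ∈ closedNbhd G (insert v I) := by simp [closedNbhd_insert hv, hy]
  have hy2 : y ∉ insert v I := by
    rw [Finset.mem_insert, not_or]
    exact ⟨hvy.1.ne', fun h => hvy.2 (mem_closedNbhd.2 (Or.inl h))⟩
  have hnew : ∀ z ∈ dead G (insert v I), z ∉ dead G I → GreedyInv G (insert v I) := by
    intro z hz hz'
    have h3 : (dead G I).card < (dead G (insert v I)).card :=
      Finset.card_lt_card (Finset.ssubset_iff_subset_ne.2 ⟨hsub, fun h => hz' (h ▸ hz)⟩)
    exact ⟨Finset.insert_nonempty _ _, hc', Or.inl (by omega)⟩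
  rcases Nat.lt_trichotomy (outer G (insert v I) y).card 1 with h0 | h0 | h0
  · refine ⟨_, hnew y (mem_dead.2 ⟨hy1, hy2, Finset.card_eq_zero.1 (by omega)⟩) ?_, by omega⟩
    exact fun h => hvy.2 (mem_dead.1 h).1
  · by_cases hw : ∃ w ∈ closedNbhd G I, w ≠ v ∧ G.Adj w y
    · obtain ⟨w, hw, hwv, hwy⟩ := hw
      have hyw : y ∈ outer G I w := mem_outer.2 ⟨hwy, hvy.2⟩
      have hwI : w ∉ I := fun h => hvy.2 (mem_closedNbhd.2 (Or.inr ⟨w, h, hwy⟩))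
      refine ⟨_, hnew w (mem_dead.2 ⟨?_, ?_, ?_⟩) ?_, by omega⟩
      · rw [closedNbhd_insert hv]; exact Finset.mem_union_left _ hw
      · simp [hwv, hwI]
      · rw [outer_insert hv, hy, Finset.sdiff_eq_empty_iff_subset]
        have := hbig w hw hwI
        exact fun z hz => Finset.mem_singleton.2 (Finset.card_le_one.1 (by omega) z hz y hyw)
      · intro h
        simp [(mem_dead.1 h).2.2] at hyw
    · push Not at hw
      refine ⟨insert v I, ⟨Finset.insert_nonempty _ _, hc', Or.inr ⟨by omega, y, hy1, hy2,
        Finset.card_pos.1 (by omega), ?_⟩⟩, by omega⟩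
      have hnb : G.neighborFinset y = insert v (outer G (insert v I) y) := by
        ext z
        rw [SimpleGraph.mem_neighborFinset, Finset.mem_insert, mem_outer, closedNbhd_insert hv, hy]
        constructor
        · intro hz
          by_cases hzv : z = v
          · exact Or.inl hzv
          · refine Or.inr ⟨hz, ?_⟩
            rw [Finset.mem_union, Finset.mem_singleton, not_or]
            exact ⟨fun h => hw z h hzv hz.symm, hz.ne'⟩
        · rintro (rfl | h)
          · exact hvy.1.symm
          · exact h.1
      rw [← SimpleGraph.card_neighborFinset_eq_degree, hnb, Finset.card_insert_of_notMem, h0]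
      intro h
      rw [mem_outer, closedNbhd_insert hv] at h
      exact h.2 (Finset.mem_union_left _ hv)
  · refine ⟨insert y (insert v I), ⟨Finset.insert_nonempty _ _,
      hc'.insert_of_mem_closedNbhd hy1 hy2, Or.inl ?_⟩, ?_⟩
    · have h3 := potential_insert hy1 hy2
      have h4 := Finset.card_le_card (dead_subset_insert hy1 (Finset.card_pos.1 (by omega)))
      split_ifs at h3 hδ h1 <;> omega
    · rw [Finset.card_insert_of_notMem hy2]; omega

/-- A large and cheap connected dominating set. -/
theorem exists_dominating (hG : G.Connected) (hn : 2 ≤ Fintype.card V) :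
    ∃ I : Finset V, I.Nonempty ∧ InnerConnected G I ∧ (∀ x, x ∉ I → ∃ u ∈ I, G.Adj u x) ∧
      Fintype.card V + 1 ≤ 4 * (Finset.univ \ I).card + (degTwo G I).card := by
  obtain ⟨r⟩ := hG.nonempty
  have : Nontrivial V := Fintype.one_lt_card_iff_nontrivial.1 (by omega)
  have hstart : GreedyInv G {r} := by
    refine ⟨by simp, ?_, Or.inl ?_⟩
    · intro x hx y hy
      rw [Finset.mem_singleton.1 hx, Finset.mem_singleton.1 hy]
    · have h1 : closedNbhd G {r} = insert r (G.neighborFinset r) := by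
        ext x; simp [mem_closedNbhd]
      have h2 := hG.preconnected.degree_pos_of_nontrivial r
      rw [potential, h1, Finset.card_insert_of_notMem (by simp),
        SimpleGraph.card_neighborFinset_eq_degree]
      simp only [Finset.card_singleton]
      push_cast
      omega
  obtain ⟨I, hI, hmax⟩ : ∃ I, GreedyInv G I ∧ ∀ J, GreedyInv G J → J.card ≤ I.card := by
    classical
    obtain ⟨I, hI, hmax⟩ := Finset.exists_max_image
      (Finset.univ.filter fun I : Finset V => GreedyInv G I) Finset.card
        ⟨{r}, by simpa using hstart⟩
    exact ⟨I, by simpa using hI, fun J hJ => hmax J (by simpa using hJ)⟩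
  have hdead : ∀ x ∈ closedNbhd G I, x ∉ I → outer G I x = ∅ := by
    intro x hx hxI
    by_contra h
    obtain ⟨J, hJ, hlt⟩ := hI.step hx hxI (Finset.nonempty_iff_ne_empty.2 h)
    exact absurd (hmax J hJ) (by omega)
  have hclosed : ∀ x ∈ closedNbhd G I, ∀ y, G.Adj x y → y ∈ closedNbhd G I := by
    intro x hx y hxy
    by_contra hy
    by_cases hxI : x ∈ I
    · exact hy (mem_closedNbhd.2 (Or.inr ⟨x, hxI, hxy⟩))
    · have : y ∈ outer G I x := mem_outer.2 ⟨hxy, hy⟩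
      simp [hdead x hx hxI] at this
  obtain ⟨hne, hc, hp⟩ := hI
  obtain ⟨u, hu⟩ := hne
  have huniv : closedNbhd G I = Finset.univ := by
    refine Finset.eq_univ_of_forall fun x => ?_
    have h := (SimpleGraph.reachable_iff_reflTransGen u x).1 (hG.preconnected u x)
    induction h with
    | refl => exact mem_closedNbhd.2 (Or.inl hu)
    | tail _ h ih => exact hclosed _ ih _ h
  refine ⟨I, ⟨u, hu⟩, hc, fun x hx => ?_, ?_⟩
  · exact (mem_closedNbhd.1 (huniv ▸ Finset.mem_univ x)).resolve_left hx
  · have hp' : 1 ≤ potential G I := by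
      rcases hp with hp | ⟨-, x, hx, hxI, hxo, -⟩
      · exact hp
      · simp [hdead x hx hxI] at hxo
    have hd : dead G I = Finset.univ \ I := by
      ext x
      have hx : x ∈ closedNbhd G I := huniv ▸ Finset.mem_univ x
      simp only [mem_dead, Finset.mem_sdiff, Finset.mem_univ, true_and, hx]
      exact ⟨fun h => h.1, fun h => ⟨h, hdead x hx h⟩⟩
    rw [potential, huniv, hd, Finset.card_univ] at hp'
    have := Finset.card_sdiff_add_card_eq_card (Finset.subset_univ I)
    rw [Finset.card_univ] at this
    omega

end Greedy

section Skeleton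

variable {V : Type*} [DecidableEq V] {G : SimpleGraph V}

/-- The vertices reached from `r` or `r'` by a walk of length `k`. -/
def Level (H : SimpleGraph V) (r r' : V) : ℕ → V → Prop
  | 0, v => v = r ∨ v = r'
  | k + 1, v => ∃ p, Level H r r' k p ∧ H.Adj p v

open Classical in
theorem exists_tree {I : Finset V} (hc : InnerConnected G I) {r r' : V} (hr : r ∈ I)
    (hrr : r ≠ r') : ∃ (par : V → V) (rk : V → ℕ), par r = r' ∧ par r' = r ∧
      rk r = 0 ∧ rk r' = 0 ∧ ∀ v ∈ I, v ≠ r → v ≠ r' →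
        par v ∈ I ∧ G.Adj (par v) v ∧ rk v = rk (par v) + 1 := by
  let H := innerGraph G I
  have hex : ∀ v ∈ I, ∃ k, Level H r r' k v := by
    intro v hv
    have h := (SimpleGraph.reachable_iff_reflTransGen r v).1 (hc r hr v hv)
    clear hv
    induction h with
    | refl => exact ⟨0, Or.inl rfl⟩
    | tail _ h ih =>
      obtain ⟨k, hk⟩ := ih
      exact ⟨k + 1, _, hk, h⟩
  let rk : V → ℕ := fun v => if h : ∃ k, Level H r r' k v then Nat.find h else 0
  have rk_spec : ∀ v, (∃ k, Level H r r' k v) → Level H r r' (rk v) v := fun v h => by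
    simp only [rk, dif_pos h]
    exact Nat.find_spec h
  have rk_le : ∀ v k, Level H r r' k v → rk v ≤ k := fun v k h => by
    simp only [rk, dif_pos (⟨k, h⟩ : ∃ k, Level H r r' k v)]
    exact Nat.find_min' _ h
  have hp : ∀ v, ∃ p, v ∈ I → v ≠ r → v ≠ r' → p ∈ I ∧ G.Adj p v ∧ rk v = rk p + 1 := by
    intro v
    by_cases h : v ∈ I ∧ v ≠ r ∧ v ≠ r'
    · obtain ⟨hv, h1, h2⟩ := h
      have hl := rk_spec v (hex v hv)
      rcases hk : rk v with _ | k
      · rw [hk] at hl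
        rcases hl with rfl | rfl
        · exact absurd rfl h1
        · exact absurd rfl h2
      · rw [hk] at hl
        obtain ⟨p, hp, hpv⟩ := hl
        refine ⟨p, fun _ _ _ => ⟨hpv.2.1, hpv.1, ?_⟩⟩
        have h3 := rk_le p k hp
        have h4 := rk_le v (rk p + 1) ⟨p, rk_spec p ⟨k, hp⟩, hpv⟩
        omega
    · exact ⟨v, fun a b c => absurd ⟨a, b, c⟩ h⟩
  choose p hp using hp
  refine ⟨fun v => if v = r then r' else if v = r' then r else p v, rk, by simp,
    by simp [hrr.symm], ?_, ?_, fun v hv h1 h2 => by simpa [h1, h2] using hp v hv h1 h2⟩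
  · exact Nat.le_zero.1 (rk_le r 0 (Or.inl rfl))
  · exact Nat.le_zero.1 (rk_le r' 0 (Or.inr rfl))

/-- A childless vertex of a spanning tree can be removed without disconnecting the graph. -/
theorem InnerConnected.erase {I : Finset V} {r r' : V} (hr : r ∈ I) (hr' : r' ∈ I)
    (hrr : G.Adj r r') {par : V → V} {rk : V → ℕ}
    (hp : ∀ v ∈ I, v ≠ r → v ≠ r' → par v ∈ I ∧ G.Adj (par v) v ∧ rk v = rk (par v) + 1)
    {v : V} (hv : ∀ u ∈ I, u ≠ r → u ≠ r' → par u ≠ v) : InnerConnected G (I.erase v) := by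
  obtain ⟨s, hs, hsI⟩ : ∃ s, (s = r ∨ s = r') ∧ s ∈ I.erase v := by
    by_cases h : r = v
    · exact ⟨r', Or.inr rfl, Finset.mem_erase.2 ⟨h ▸ hrr.ne', hr'⟩⟩
    · exact ⟨r, Or.inl rfl, Finset.mem_erase.2 ⟨h, hr⟩⟩
  have key : ∀ n, ∀ u ∈ I.erase v, rk u = n → (innerGraph G (I.erase v)).Reachable s u := by
    intro n
    induction n using Nat.strong_induction_on with
    | _ n ih =>
      intro u hu hn
      obtain ⟨huv, huI⟩ := Finset.mem_erase.1 hu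
      by_cases h1 : u = r
      · rcases hs with rfl | rfl
        · rw [h1]
        · exact SimpleGraph.Adj.reachable ⟨h1 ▸ hrr.symm, hsI, hu⟩
      by_cases h2 : u = r'
      · rcases hs with rfl | rfl
        · exact SimpleGraph.Adj.reachable ⟨h2 ▸ hrr, hsI, hu⟩
        · rw [h2]
      obtain ⟨h3, h4, h5⟩ := hp u huI h1 h2
      have h6 : par u ∈ I.erase v := Finset.mem_erase.2 ⟨hv u huI h1 h2, h3⟩
      exact (ih (rk (par u)) (by omega) _ h6 rfl).trans (SimpleGraph.Adj.reachable ⟨h4, h6, hu⟩)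
  exact fun x hx y hy => (key _ x hx rfl).symm.trans (key _ y hy rfl)

/-- A cheap connected dominating set with a spanning tree rooted at an edge, such that childless
vertices have private neighbors. -/
structure Skeleton (G : SimpleGraph V) [Fintype V] [DecidableRel G.Adj] where
  /-- the dominating set -/
  I : Finset V
  /-- one end of the root edge -/
  r : V
  /-- the other end of the root edge -/
  r' : V
  /-- the parent of a vertex of `I` -/
  par : V → V
  /-- the distance to the root edge -/
  rk : V → ℕ
  r_mem : r ∈ I
  r'_mem : r' ∈ I
  adj : G.Adj r r'
  par_r : par r = r'
  par_r' : par r' = r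
  rk_r : rk r = 0
  rk_r' : rk r' = 0
  par_mem : ∀ v ∈ I, v ≠ r → v ≠ r' → par v ∈ I ∧ G.Adj (par v) v ∧ rk v = rk (par v) + 1
  dom : ∀ x, x ∉ I → ∃ u ∈ I, G.Adj u x
  count : Fintype.card V + 1 ≤ 4 * (Finset.univ \ I).card + (degTwo G I).card
  priv : ∀ v ∈ I, (∀ u ∈ I, u ≠ r → u ≠ r' → par u ≠ v) → ∃ w ∉ I, ∀ u ∈ I, G.Adj u w ↔ u = v

theorem exists_skeleton [Fintype V] [DecidableRel G.Adj] (hG : G.Connected)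
    (hn : 2 ≤ Fintype.card V) : (∃ r, ∀ x, x ≠ r → G.Adj r x) ∨ Nonempty (Skeleton G) := by
  classical
  let P : Finset V → Prop := fun I => I.Nonempty ∧ InnerConnected G I ∧
    (∀ x, x ∉ I → ∃ u ∈ I, G.Adj u x) ∧
      Fintype.card V + 1 ≤ 4 * (Finset.univ \ I).card + (degTwo G I).card
  obtain ⟨I, hI, hmin⟩ : ∃ I, P I ∧ ∀ J, P J → I.card ≤ J.card := by
    obtain ⟨I₀, hI₀⟩ := exists_dominating hG hn
    obtain ⟨I, hI, hmin⟩ := Finset.exists_min_image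
      (Finset.univ.filter P) Finset.card ⟨I₀, Finset.mem_filter.2 ⟨Finset.mem_univ _, hI₀⟩⟩
    exact ⟨I, (Finset.mem_filter.1 hI).2, fun J hJ =>
      hmin J (Finset.mem_filter.2 ⟨Finset.mem_univ _, hJ⟩)⟩
  obtain ⟨⟨r, hr⟩, hc, hd, hcount⟩ := hI
  by_cases hr' : ∃ x ∈ I, x ≠ r
  · right
    obtain ⟨x, hx, hxr⟩ := hr'
    obtain ⟨r', hrr⟩ : ∃ r', (innerGraph G I).Adj r r' := by
      have h := (SimpleGraph.reachable_iff_reflTransGen r x).1 (hc r hr x hx)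
      rcases h.cases_head with h | ⟨c, h, -⟩
      · exact absurd h.symm hxr
      · exact ⟨c, h⟩
    obtain ⟨hrr, -, hr'⟩ := hrr
    obtain ⟨par, rk, h1, h2, h3, h4, h5⟩ := exists_tree hc hr hrr.ne
    refine ⟨⟨I, r, r', par, rk, hr, hr', hrr, h1, h2, h3, h4, h5, hd, hcount, fun v hv hch => ?_⟩⟩
    have hce := InnerConnected.erase hr hr' hrr h5 hch
    have hcard := Finset.card_erase_add_one hv
    have hnot : ¬ P (I.erase v) := fun h => by have := hmin _ h; omega
    have hne : (I.erase v).Nonempty := by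
      by_cases h : r = v
      · exact ⟨r', Finset.mem_erase.2 ⟨h ▸ hrr.ne', hr'⟩⟩
      · exact ⟨r, Finset.mem_erase.2 ⟨h, hr⟩⟩
    have hcount' : Fintype.card V + 1 ≤
        4 * (Finset.univ \ I.erase v).card + (degTwo G (I.erase v)).card := by
      have e1 := Finset.card_sdiff_add_card_eq_card (Finset.subset_univ I)
      have e2 := Finset.card_sdiff_add_card_eq_card (Finset.subset_univ (I.erase v))
      have e3 : (degTwo G I).card ≤ (degTwo G (I.erase v)).card + 1 := by
        rw [degTwo, degTwo, Finset.filter_erase]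
        have := Finset.pred_card_le_card_erase (s := I.filter fun x => G.degree x = 2) (a := v)
        omega
      omega
    have hnd : ¬ ∀ x, x ∉ I.erase v → ∃ u ∈ I.erase v, G.Adj u x := fun h =>
      hnot ⟨hne, hce, h, hcount'⟩
    push Not at hnd
    obtain ⟨w, hw, hw'⟩ := hnd
    have hwI : w ∉ I := by
      intro h
      have hwv : w = v := by
        by_contra hwv
        exact hw (Finset.mem_erase.2 ⟨hwv, h⟩)
      subst hwv
      by_cases e1 : w = r
      · exact hw' r' (Finset.mem_erase.2 ⟨e1 ▸ hrr.ne', hr'⟩) (e1 ▸ hrr.symm)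
      by_cases e2 : w = r'
      · exact hw' r (Finset.mem_erase.2 ⟨e2 ▸ hrr.ne, hr⟩) (e2 ▸ hrr)
      obtain ⟨e3, e4, -⟩ := h5 w h e1 e2
      exact hw' (par w) (Finset.mem_erase.2 ⟨e4.ne, e3⟩) e4
    refine ⟨w, hwI, fun u hu => ⟨fun h => ?_, ?_⟩⟩
    · by_contra huv
      exact hw' u (Finset.mem_erase.2 ⟨huv, hu⟩) h
    · rintro rfl
      obtain ⟨u', hu', h⟩ := hd w hwI
      have : u' = u := by
        by_contra huv
        exact hw' u' (Finset.mem_erase.2 ⟨huv, hu'⟩) h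
      exact this ▸ h
  · left
    push Not at hr'
    refine ⟨r, fun x hx => ?_⟩
    obtain ⟨u, hu, hux⟩ := hd x fun h => hx (hr' x h)
    exact hr' u hu ▸ hux

end Skeleton

section LeafChoice

variable {V : Type*} [DecidableEq V] [Fintype V] {G : SimpleGraph V} [DecidableRel G.Adj]

/-- A leaf with a neighbor that is a leaf, too. -/
def Skeleton.OuterLeaf (S : Skeleton G) (x : V) : Prop := x ∉ S.I ∧ ∃ y, y ∉ S.I ∧ G.Adj x y

/-- A leaf with at least two neighbors, all of them inner vertices. -/
def Skeleton.InnerLeaf (S : Skeleton G) (x : V) : Prop :=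
  x ∉ S.I ∧ G.degree x ≠ 1 ∧ ∀ y, G.Adj x y → y ∈ S.I

noncomputable instance (S : Skeleton G) : DecidablePred S.OuterLeaf := Classical.decPred _

noncomputable instance (S : Skeleton G) : DecidablePred S.InnerLeaf := Classical.decPred _

/-- A choice, for every leaf, of a parent `φ` and of a second distinguished neighbor `s`. The set
`C` consists of the inner vertices all of whose neighbors are distinguished. -/
structure LeafChoice (S : Skeleton G) where
  /-- the parent of a leaf -/
  φ : V → V
  /-- the second distinguished neighbor of a leaf -/
  s : V → V
  /-- the closed vertices -/
  C : Finset V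
  C_sub : C ⊆ S.I
  φ_mem : ∀ x, x ∉ S.I → φ x ∈ S.I
  φ_adj : ∀ x, x ∉ S.I → G.Adj x (φ x)
  s_adj : ∀ x, x ∉ S.I → G.degree x ≠ 1 → G.Adj x (s x)
  s_ne : ∀ x, x ∉ S.I → G.degree x ≠ 1 → s x ≠ φ x
  s_outer : ∀ x, S.OuterLeaf x → s x ∉ S.I
  closed_mem : ∀ v ∈ C, ∀ y ∈ S.I, G.Adj v y → S.par y = v ∨ S.par v = y
  closed_outer : ∀ v ∈ C, ∀ y, S.OuterLeaf y → G.Adj v y → φ y = v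
  closed_inner : ∀ v ∈ C, ∀ y, S.InnerLeaf y → G.Adj v y → φ y = v ∨ s y = v
  not_closed : ∀ v ∈ S.I, v ∉ C → ∃ y, G.Adj v y ∧
    ((y ∈ S.I ∧ S.par y ≠ v ∧ S.par v ≠ y) ∨ (y ∉ S.I ∧ φ y ≠ v ∧ s y ≠ v))
  balanced : ∀ v ∈ C, |((Finset.univ.filter fun x => S.InnerLeaf x ∧ φ x = v).card : ℤ) -
    (Finset.univ.filter fun x => S.InnerLeaf x ∧ s x = v).card| ≤ 1
  total : 0 ≤ ∑ v ∈ C, (((Finset.univ.filter fun x => S.InnerLeaf x ∧ φ x = v).card : ℤ) -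
    (Finset.univ.filter fun x => S.InnerLeaf x ∧ s x = v).card)

namespace Skeleton

variable (S : Skeleton G)

theorem degree_pos {x : V} (hx : x ∉ S.I) : 0 < G.degree x := by
  obtain ⟨u, -, hu⟩ := S.dom x hx
  exact (G.degree_pos_iff_exists_adj x).2 ⟨u, hu.symm⟩

omit [DecidableEq V] in
theorem eq_of_degree_eq_one {x u v : V} (hx : G.degree x = 1) (hu : G.Adj x u) (hv : G.Adj x v) :
    u = v := by
  rw [← SimpleGraph.card_neighborFinset_eq_degree] at hx
  exact Finset.card_le_one.1 hx.le u (by simpa using hu) v (by simpa using hv)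

variable {S} in
theorem OuterLeaf.degree_ne_one {x : V} (hx : S.OuterLeaf x) : G.degree x ≠ 1 := by
  intro h
  obtain ⟨hx, y, hy, hxy⟩ := hx
  obtain ⟨u, hu, hux⟩ := S.dom x hx
  exact hy (eq_of_degree_eq_one h hux.symm hxy ▸ hu)

variable {S} in
theorem InnerLeaf.not_outerLeaf {x : V} (hx : S.InnerLeaf x) : ¬ S.OuterLeaf x :=
  fun ⟨_, y, hy, hxy⟩ => hy (hx.2.2 y hxy)

theorem leaf_cases {x : V} (hx : x ∉ S.I) :
    G.degree x = 1 ∨ S.OuterLeaf x ∨ S.InnerLeaf x := by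
  by_cases h1 : G.degree x = 1
  · exact Or.inl h1
  by_cases h2 : S.OuterLeaf x
  · exact Or.inr (Or.inl h2)
  refine Or.inr (Or.inr ⟨hx, h1, fun y hy => ?_⟩)
  by_contra h
  exact h2 ⟨hx, y, h, hy⟩

theorem exists_leafChoice : Nonempty (LeafChoice S) := by
  classical
  have h1 : ∀ x, ∃ u, x ∉ S.I → u ∈ S.I ∧ G.Adj x u := fun x => by
    by_cases hx : x ∈ S.I
    · exact ⟨x, fun h => absurd hx h⟩
    · obtain ⟨u, hu, hux⟩ := S.dom x hx
      exact ⟨u, fun _ => ⟨hu, hux.symm⟩⟩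
  have h2 : ∀ x, ∃ y, S.OuterLeaf x → y ∉ S.I ∧ G.Adj x y := fun x => by
    by_cases hx : S.OuterLeaf x
    · obtain ⟨y, hy⟩ := hx.2
      exact ⟨y, fun _ => hy⟩
    · exact ⟨x, fun h => absurd h hx⟩
  have h3 : ∀ x, ∃ a b, S.InnerLeaf x → a ≠ b ∧ G.Adj x a ∧ G.Adj x b := fun x => by
    by_cases hx : S.InnerLeaf x
    · have := S.degree_pos hx.1
      have := hx.2.1
      obtain ⟨a, ha, b, hb, hab⟩ := Finset.one_lt_card.1
        (show 1 < (G.neighborFinset x).card by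
          rw [SimpleGraph.card_neighborFinset_eq_degree]; omega)
      exact ⟨a, b, fun _ => ⟨hab, by simpa using ha, by simpa using hb⟩⟩
    · exact ⟨x, x, fun h => absurd h hx⟩
  choose φ₁ hφ₁ using h1
  choose s₁ hs₁ using h2
  choose a b hab using h3
  let p : V → Prop := fun v => v ∈ S.I ∧ ∀ y, G.Adj v y →
    (y ∈ S.I → S.par y = v ∨ S.par v = y) ∧ (S.OuterLeaf y → φ₁ y = v) ∧
      (S.InnerLeaf y → a y = v ∨ b y = v)
  obtain ⟨h, t, hht, hbal, htot⟩ := exists_orientation (Finset.univ.filter S.InnerLeaf) a b p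
  let φ : V → V := fun x => if S.InnerLeaf x then h x else φ₁ x
  let s : V → V := fun x => if S.InnerLeaf x then t x else s₁ x
  have eφ : ∀ v, (Finset.univ.filter fun x => S.InnerLeaf x ∧ φ x = v) =
      (Finset.univ.filter S.InnerLeaf).filter fun x => h x = v := fun v => by
    ext x
    simp only [Finset.mem_filter, Finset.mem_univ, true_and, and_congr_right_iff]
    intro hx
    simp [φ, hx]
  have es : ∀ v, (Finset.univ.filter fun x => S.InnerLeaf x ∧ s x = v) =
      (Finset.univ.filter S.InnerLeaf).filter fun x => t x = v := fun v => by
    ext x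
    simp only [Finset.mem_filter, Finset.mem_univ, true_and, and_congr_right_iff]
    intro hx
    simp [s, hx]
  have inner : ∀ x, S.InnerLeaf x → (φ x = a x ∧ s x = b x) ∨ (φ x = b x ∧ s x = a x) :=
    fun x hx => by simpa [φ, s, hx] using hht x
  have outer : ∀ x, S.OuterLeaf x → φ x = φ₁ x ∧ s x = s₁ x := fun x hx => by
    have : ¬ S.InnerLeaf x := fun h => h.not_outerLeaf hx
    simp [φ, s, this]
  have φ_adj : ∀ x, x ∉ S.I → G.Adj x (φ x) := fun x hx => by
    by_cases hi : S.InnerLeaf x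
    · obtain ⟨-, h4, h5⟩ := hab x hi
      rcases inner x hi with h | h <;> simp [h, h4, h5]
    · simpa [φ, hi] using (hφ₁ x hx).2
  have s_prop : ∀ x, x ∉ S.I → G.degree x ≠ 1 → G.Adj x (s x) ∧ s x ≠ φ x := fun x hx hd => by
    rcases S.leaf_cases hx with hi | hi | hi
    · exact absurd hi hd
    · rw [(outer x hi).1, (outer x hi).2]
      exact ⟨(hs₁ x hi).2, fun h => (hs₁ x hi).1 (h ▸ (hφ₁ x hx).1)⟩
    · obtain ⟨h3, h4, h5⟩ := hab x hi
      rcases inner x hi with h | h <;> simp [h, h3, h4, h5, h3.symm]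
  refine ⟨⟨φ, s, Finset.univ.filter p, fun v hv => (Finset.mem_filter.1 hv).2.1, fun x hx => ?_,
    φ_adj, fun x hx hd => (s_prop x hx hd).1, fun x hx hd => (s_prop x hx hd).2,
    fun x hx => ?_, fun v hv y hy hvy => ?_, fun v hv y hy hvy => ?_, fun v hv y hy hvy => ?_,
    fun v hv hvC => ?_, fun v hv => ?_, ?_⟩⟩
  · by_cases hi : S.InnerLeaf x
    · exact hi.2.2 _ (φ_adj x hx)
    · simpa [φ, hi] using (hφ₁ x hx).1
  · rw [(outer x hx).2]
    exact (hs₁ x hx).1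
  · exact ((Finset.mem_filter.1 hv).2.2 y hvy).1 hy
  · rw [(outer y hy).1]
    exact ((Finset.mem_filter.1 hv).2.2 y hvy).2.1 hy
  · have := ((Finset.mem_filter.1 hv).2.2 y hvy).2.2 hy
    rcases inner y hy with h | h <;> rw [h.1, h.2]
    · exact this
    · exact this.symm
  · have hp : ¬ p v := fun h => hvC (by simpa using h)
    simp only [p, hv, true_and, not_forall] at hp
    obtain ⟨y, hy, hp⟩ := hp
    refine ⟨y, hy, ?_⟩
    by_cases h4 : y ∈ S.I
    · have h5 : ¬ S.OuterLeaf y := fun h => h.1 h4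
      have h6 : ¬ S.InnerLeaf y := fun h => h.1 h4
      simp only [h4, h5, h6, false_imp_iff, and_true, true_imp_iff, not_or] at hp
      exact Or.inl ⟨h4, hp⟩
    · right
      refine ⟨h4, ?_⟩
      rcases S.leaf_cases h4 with hi | hi | hi
      · have h5 : ¬ S.OuterLeaf y := fun h => h.degree_ne_one hi
        have h6 : ¬ S.InnerLeaf y := fun h => h.2.1 hi
        simp [h4, h5, h6] at hp
      · have h6 : ¬ S.InnerLeaf y := fun h => h.not_outerLeaf hi
        simp only [h4, hi, h6, false_imp_iff, and_true, true_imp_iff, true_and] at hp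
        rw [(outer y hi).1, (outer y hi).2]
        exact ⟨hp, fun h => (hs₁ y hi).1 (h ▸ hv)⟩
      · have h5 := hi.not_outerLeaf
        simp only [h4, hi, h5, false_imp_iff, true_imp_iff, true_and, not_or] at hp
        rcases inner y hi with h | h <;> rw [h.1, h.2]
        · exact hp
        · exact hp.symm
  · rw [eφ, es]
    exact hbal v (Finset.mem_filter.1 hv).2
  · simp only [eφ, es]
    exact htot

end Skeleton

end LeafChoice

namespace LeafChoice

variable {V : Type*} [DecidableEq V] [Fintype V] {G : SimpleGraph V} [DecidableRel G.Adj]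
  {S : Skeleton G} (K : LeafChoice S)

/-- The children of `v` that are inner vertices or pendant. -/
noncomputable def A (v : V) : List V :=
  (Finset.univ.filter fun y => (y ∈ S.I ∧ y ≠ S.r ∧ y ≠ S.r' ∧ S.par y = v) ∨
    (y ∉ S.I ∧ G.degree y = 1 ∧ K.φ y = v)).toList

/-- The children of `v` that are outer leaves. -/
noncomputable def outerChildren (v : V) : List V :=
  (Finset.univ.filter fun y => S.OuterLeaf y ∧ K.φ y = v).toList

/-- The children of `v` that are inner leaves. -/
noncomputable def innerChildren (v : V) : List V :=
  (Finset.univ.filter fun y => S.InnerLeaf y ∧ K.φ y = v).toList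

/-- The children of `v` that are leaves of degree at least two. -/
noncomputable def B (v : V) : List V := K.outerChildren v ++ K.innerChildren v

/-- The edge from `v` to `y` does not belong to the tree. -/
def NonTree (v y : V) : Prop :=
  G.Adj v y ∧ ((y ∈ S.I ∧ S.par y ≠ v ∧ S.par v ≠ y) ∨ (y ∉ S.I ∧ K.φ y ≠ v))

/-- The neighbor `y` is entered from `v` through a port that is at least three. -/
def Good (v y : V) : Prop := y ∈ S.I ∨ K.s y ≠ v

noncomputable instance (v : V) : DecidablePred (K.NonTree v) := Classical.decPred _

noncomputable instance (v : V) : DecidablePred (K.Good v) := Classical.decPred _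

/-- The neighbors of `v` that are not joined to `v` by an edge of the tree. -/
noncomputable def N (v : V) : List V :=
  (Finset.univ.filter fun y => K.NonTree v y ∧ K.Good v y).toList ++
    (Finset.univ.filter fun y => K.NonTree v y ∧ ¬ K.Good v y).toList

/-- The vertex `x` is the first or the last element of the list of its leaf siblings. -/
def Flagged (x : V) : Prop := (K.B (K.φ x)).head? = some x ∨ (K.B (K.φ x)).getLast? = some x

noncomputable instance : DecidablePred K.Flagged := Classical.decPred _

/-- The order of the neighbors of a leaf. -/
noncomputable def leafOrd (x : V) : List V :=
  if G.degree x = 1 then [K.φ x]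
  else (if K.Flagged x then [K.s x, K.φ x] else [K.φ x, K.s x]) ++
    (Finset.univ.filter fun y => G.Adj x y ∧ y ≠ K.φ x ∧ y ≠ K.s x).toList

/-- The order of the neighbors of a vertex. -/
noncomputable def ord (v : V) : List V :=
  if v ∈ S.I then S.par v :: (K.A v ++ (K.B v ++ K.N v)) else K.leafOrd v

/-- The parent in the spanning tree. -/
def par (v : V) : V := if v ∈ S.I then S.par v else K.φ v

/-- The distance from the root edge in the spanning tree. -/
def rk (v : V) : ℕ := if v ∈ S.I then S.rk v else S.rk (K.φ v) + 1

/-- The number of edges by which `v` is the parent of an inner leaf. -/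
noncomputable def indeg (v : V) : ℕ := (Finset.univ.filter fun x => S.InnerLeaf x ∧ K.φ x = v).card

/-- The number of edges by which `v` is the second neighbor of an inner leaf. -/
noncomputable def outdeg (v : V) : ℕ := (Finset.univ.filter fun x => S.InnerLeaf x ∧ K.s x = v).card

/-- Half of the number of steps spent at `v` on edges that are not in the tree. -/
noncomputable def cost (v : V) : ℕ :=
  if v ∉ S.I ∨ G.degree v = 2 then 0
  else if v ∈ K.C then (1 - ((K.indeg v : ℤ) - K.outdeg v)).toNat else 1

theorem mem_A {v y : V} : y ∈ K.A v ↔ (y ∈ S.I ∧ y ≠ S.r ∧ y ≠ S.r' ∧ S.par y = v) ∨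
    (y ∉ S.I ∧ G.degree y = 1 ∧ K.φ y = v) := by
  simp [A]

theorem mem_outerChildren {v y : V} :
    y ∈ K.outerChildren v ↔ S.OuterLeaf y ∧ K.φ y = v := by
  simp [outerChildren]

theorem mem_innerChildren {v y : V} :
    y ∈ K.innerChildren v ↔ S.InnerLeaf y ∧ K.φ y = v := by
  simp [innerChildren]

theorem mem_B {v y : V} : y ∈ K.B v ↔ y ∉ S.I ∧ G.degree y ≠ 1 ∧ K.φ y = v := by
  rw [B, List.mem_append, mem_outerChildren, mem_innerChildren]
  constructor
  · rintro (⟨h, h'⟩ | ⟨h, h'⟩)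
    · exact ⟨h.1, h.degree_ne_one, h'⟩
    · exact ⟨h.1, h.2.1, h'⟩
  · rintro ⟨h1, h2, h3⟩
    have := S.leaf_cases h1
    tauto

theorem mem_N {v y : V} : y ∈ K.N v ↔ K.NonTree v y := by
  simp only [N, List.mem_append, Finset.mem_toList, Finset.mem_filter, Finset.mem_univ, true_and]
  tauto

theorem par_mem {v : V} (hv : v ∈ S.I) : S.par v ∈ S.I ∧ G.Adj v (S.par v) := by
  by_cases h1 : v = S.r
  · subst h1; rw [S.par_r]; exact ⟨S.r'_mem, S.adj⟩
  by_cases h2 : v = S.r'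
  · subst h2; rw [S.par_r']; exact ⟨S.r_mem, S.adj.symm⟩
  obtain ⟨h3, h4, -⟩ := S.par_mem v hv h1 h2
  exact ⟨h3, h4.symm⟩

/-- Two vertices that are parents of each other form the root edge. -/
theorem root_of_par_par {v : V} (hv : v ∈ S.I) (h : S.par (S.par v) = v) :
    v = S.r ∨ v = S.r' := by
  by_contra hr
  push Not at hr
  obtain ⟨h1, -, h2⟩ := S.par_mem v hv hr.1 hr.2
  by_cases h3 : S.par v = S.r
  · rw [h3, S.par_r] at h; exact hr.2 h.symm
  by_cases h4 : S.par v = S.r'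
  · rw [h4, S.par_r'] at h; exact hr.1 h.symm
  obtain ⟨-, -, h5⟩ := S.par_mem _ h1 h3 h4
  rw [h] at h5
  omega

theorem ord_of_mem {v : V} (hv : v ∈ S.I) :
    K.ord v = S.par v :: (K.A v ++ (K.B v ++ K.N v)) := if_pos hv

theorem ord_of_notMem {v : V} (hv : v ∉ S.I) : K.ord v = K.leafOrd v := if_neg hv

theorem nodup_B (v : V) : (K.B v).Nodup := by
  rw [B, List.nodup_append]
  refine ⟨Finset.nodup_toList _, Finset.nodup_toList _, fun a ha b hb hab => ?_⟩
  subst hab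
  exact (K.mem_innerChildren.1 hb).1.not_outerLeaf (K.mem_outerChildren.1 ha).1

theorem nodup_N (v : V) : (K.N v).Nodup := by
  rw [N, List.nodup_append]
  refine ⟨Finset.nodup_toList _, Finset.nodup_toList _, fun a ha b hb hab => ?_⟩
  subst hab
  simp only [Finset.mem_toList, Finset.mem_filter] at ha hb
  exact hb.2.2 ha.2.2

theorem nodup_ord (v : V) : (K.ord v).Nodup := by
  by_cases hv : v ∈ S.I
  · rw [K.ord_of_mem hv, List.nodup_cons, List.nodup_append, List.nodup_append]
    refine ⟨fun h => ?_, Finset.nodup_toList _, ⟨K.nodup_B v, K.nodup_N v, ?_⟩, ?_⟩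
    · rw [List.mem_append, List.mem_append, mem_A, mem_B, mem_N, NonTree] at h
      have h1 := (par_mem hv).1
      rcases h with (⟨-, h2, h3, h4⟩ | h) | h | ⟨-, h | h⟩
      · rcases root_of_par_par hv h4 with rfl | rfl
        · exact h3 S.par_r
        · exact h2 S.par_r'
      · exact h.1 h1
      · exact h.1 h1
      · exact h.2.2 rfl
      · exact h.1 h1
    · rintro a ha b hb rfl
      rw [mem_B] at ha
      rw [mem_N, NonTree] at hb
      tauto
    · rintro a ha b hb rfl
      rw [mem_A] at ha
      rw [List.mem_append, mem_B, mem_N, NonTree] at hb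
      tauto
  · rw [K.ord_of_notMem hv, leafOrd]
    split_ifs with h1 h2
    · simp
    · have := K.s_ne v hv h1
      simp [this, Finset.nodup_toList]
    · have := K.s_ne v hv h1
      simp [this.symm, Finset.nodup_toList]

theorem mem_ord (v w : V) : w ∈ K.ord v ↔ G.Adj v w := by
  by_cases hv : v ∈ S.I
  · rw [K.ord_of_mem hv, List.mem_cons, List.mem_append, List.mem_append, mem_A, mem_B, mem_N,
      NonTree]
    constructor
    · rintro (rfl | (⟨h1, h2, h3, rfl⟩ | ⟨h1, h2, rfl⟩) | ⟨h1, h2, rfl⟩ | h)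
      · exact (par_mem hv).2
      · exact (par_mem h1).2.symm
      · exact (K.φ_adj w h1).symm
      · exact (K.φ_adj w h1).symm
      · exact h.1
    · intro h
      by_cases h1 : w ∈ S.I
      · by_cases h2 : S.par v = w
        · exact Or.inl h2.symm
        by_cases h3 : S.par w = v
        · right; left; left
          refine ⟨h1, ?_, ?_, h3⟩
          · rintro rfl
            rw [S.par_r] at h3
            exact h2 (h3 ▸ S.par_r')
          · rintro rfl
            rw [S.par_r'] at h3
            exact h2 (h3 ▸ S.par_r)
        · tauto
      · tauto
  · rw [K.ord_of_notMem hv, leafOrd]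
    have h0 := K.φ_adj v hv
    split_ifs with h1 h2
    · rw [List.mem_singleton]
      exact ⟨fun h => h ▸ h0, fun h => Skeleton.eq_of_degree_eq_one h1 h h0⟩
    all_goals
      have h3 := K.s_adj v hv h1
      simp only [List.mem_append, List.mem_cons, List.not_mem_nil, or_false, Finset.mem_toList,
        Finset.mem_filter, Finset.mem_univ, true_and]
      constructor
      · rintro ((rfl | rfl) | h)
        · assumption
        · assumption
        · exact h.1
      · tauto

theorem length_ord (v : V) : (K.ord v).length = G.degree v := by
  have : (K.ord v).toFinset = G.neighborFinset v := by
    ext w; simp [K.mem_ord]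
  rw [← SimpleGraph.card_neighborFinset_eq_degree, ← this,
    List.toFinset_card_of_nodup (K.nodup_ord v)]

/-- Every inner vertex has a child that is not an inner leaf. -/
theorem A_append_outerChildren_ne_nil {v : V} (hv : v ∈ S.I) :
    K.A v ++ K.outerChildren v ≠ [] := by
  intro h
  have hno : ∀ y, y ∉ K.A v ∧ y ∉ K.outerChildren v := fun y => by
    rw [← not_or, ← List.mem_append, h]; simp
  obtain ⟨w, hw, hw'⟩ := S.priv v hv fun u hu h1 h2 h3 =>
    (hno u).1 (K.mem_A.2 (Or.inl ⟨hu, h1, h2, h3⟩))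
  have e : K.φ w = v := (hw' _ (K.φ_mem w hw)).1 (K.φ_adj w hw).symm
  rcases S.leaf_cases hw with h1 | h1 | h1
  · exact (hno w).1 (K.mem_A.2 (Or.inr ⟨hw, h1, e⟩))
  · exact (hno w).2 (K.mem_outerChildren.2 ⟨h1, e⟩)
  · have h2 := K.s_adj w hw h1.2.1
    have h3 : K.s w = v := (hw' _ (h1.2.2 _ h2)).1 h2.symm
    exact K.s_ne w hw h1.2.1 (h3.trans e.symm)

theorem mem_child {v : V} (hv : v ∈ S.I) (y : V) :
    y ∈ K.A v ++ K.B v ↔ K.par y = v ∧ 1 ≤ K.rk y := by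
  rw [List.mem_append, mem_A, mem_B, par, rk]
  by_cases hy : y ∈ S.I
  · simp only [hy, not_true, true_and, false_and, or_false, if_true]
    constructor
    · rintro ⟨h1, h2, rfl⟩
      have := (S.par_mem y hy h1 h2).2.2
      exact ⟨rfl, by omega⟩
    · rintro ⟨h1, h2⟩
      refine ⟨?_, ?_, h1⟩
      · rintro rfl; rw [S.rk_r] at h2; omega
      · rintro rfl; rw [S.rk_r'] at h2; omega
  · simp only [hy, not_false_eq_true, true_and, false_and, false_or, if_false]
    have : 1 ≤ S.rk (K.φ y) + 1 := by omega
    tauto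

theorem rk_par (v : V) (h : 1 ≤ K.rk v) : K.rk v = K.rk (K.par v) + 1 ∧ K.par v ∈ S.I := by
  rw [rk] at h
  by_cases hv : v ∈ S.I
  · simp only [hv, if_true] at h
    have h1 : v ≠ S.r := by rintro rfl; rw [S.rk_r] at h; omega
    have h2 : v ≠ S.r' := by rintro rfl; rw [S.rk_r'] at h; omega
    obtain ⟨h3, -, h4⟩ := S.par_mem v hv h1 h2
    simp only [rk, par, hv, if_true, h3, and_true]
    exact h4
  · have := K.φ_mem v hv
    simp [rk, par, hv, this]

theorem root (v : V) (h : K.rk v = 0) : v = S.r ∨ v = S.r' := by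
  rw [rk] at h
  by_cases hv : v ∈ S.I
  · simp only [hv, if_true] at h
    by_contra hr
    push Not at hr
    have := (S.par_mem v hv hr.1 hr.2).2.2
    omega
  · simp [hv] at h

theorem portOf_leaf_par {x : V} (hx : x ∉ S.I) (hd : G.degree x ≠ 1) :
    portOf K.ord x (K.φ x) = if K.Flagged x then 2 else 1 := by
  split_ifs with hf
  · exact portOf_append (pre := [K.s x]) (K.nodup_ord x) (by
      rw [K.ord_of_notMem hx, leafOrd, if_neg hd, if_pos hf]; rfl)
  · exact portOf_append (pre := []) (K.nodup_ord x) (by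
      rw [K.ord_of_notMem hx, leafOrd, if_neg hd, if_neg hf]; rfl)

theorem portOf_leaf_s {x : V} (hx : x ∉ S.I) (hd : G.degree x ≠ 1) :
    portOf K.ord x (K.s x) = if K.Flagged x then 1 else 2 := by
  split_ifs with hf
  · exact portOf_append (pre := []) (K.nodup_ord x) (by
      rw [K.ord_of_notMem hx, leafOrd, if_neg hd, if_pos hf]; rfl)
  · exact portOf_append (pre := [K.φ x]) (K.nodup_ord x) (by
      rw [K.ord_of_notMem hx, leafOrd, if_neg hd, if_neg hf]; rfl)

theorem three_le_portOf {pre suf : List V} {v w : V} (hw : K.ord v = pre ++ suf)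
    (hpre : 2 ≤ pre.length) (h : w ∈ suf) : 3 ≤ portOf K.ord v w := by
  obtain ⟨l, m, rfl⟩ := List.append_of_mem h
  rw [portOf_append (pre := pre ++ l) (suf := m) (K.nodup_ord v) (by simp [hw]),
    List.length_append]
  omega

/-- The port at an inner vertex leading to an inner leaf that is a child. -/
theorem three_le_portOf_innerChild {y : V} (hy : S.InnerLeaf y) :
    3 ≤ portOf K.ord (K.φ y) y := by
  have hv := K.φ_mem y hy.1
  have h := List.length_pos_of_ne_nil (K.A_append_outerChildren_ne_nil hv)
  refine K.three_le_portOf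
    (pre := S.par (K.φ y) :: (K.A (K.φ y) ++ K.outerChildren (K.φ y)))
    (suf := K.innerChildren (K.φ y) ++ K.N (K.φ y)) ?_ (by rw [List.length_cons]; omega)
    (List.mem_append_left _ (K.mem_innerChildren.2 ⟨hy, rfl⟩))
  rw [K.ord_of_mem hv, B]
  simp

theorem ne_nil {v : V} (hv : v ∈ S.I) : K.A v ++ K.B v ≠ [] := by
  have := K.A_append_outerChildren_ne_nil hv
  rw [B]
  simp only [ne_eq, List.append_eq_nil_iff, not_and] at this ⊢
  tauto

theorem three_le_portOf_good {v y : V} (hv : v ∈ S.I) (h : K.NonTree v y) (hg : K.Good v y) :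
    3 ≤ portOf K.ord y v := by
  obtain ⟨hvy, ⟨h1, h2, h3⟩ | ⟨h1, h2⟩⟩ := h
  · have h4 := List.length_pos_of_ne_nil (K.ne_nil h1)
    refine K.three_le_portOf (pre := S.par y :: (K.A y ++ K.B y)) (suf := K.N y)
      (by rw [K.ord_of_mem h1]; simp) (by rw [List.length_cons]; omega)
      (K.mem_N.2 ⟨hvy.symm, Or.inl ⟨hv, h3, h2⟩⟩)
  · have h3 : K.s y ≠ v := hg.resolve_left h1
    have h4 : G.degree y ≠ 1 := fun h =>
      h2 (Skeleton.eq_of_degree_eq_one h (K.φ_adj y h1) hvy.symm)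
    refine K.three_le_portOf (pre := if K.Flagged y then [K.s y, K.φ y] else [K.φ y, K.s y])
      (suf := (Finset.univ.filter fun z => G.Adj y z ∧ z ≠ K.φ y ∧ z ≠ K.s y).toList)
      (by rw [K.ord_of_notMem h1, leafOrd, if_neg h4]) (by split_ifs <;> simp) ?_
    simpa using ⟨hvy.symm, h2.symm, h3.symm⟩

theorem exists_good {v y : V} (h : K.NonTree v y) (hg : K.Good v y) :
    ∃ z l, K.N v = z :: l ∧ K.NonTree v z ∧ K.Good v z := by
  have hy : y ∈ (Finset.univ.filter fun y => K.NonTree v y ∧ K.Good v y).toList := by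
    simpa using ⟨h, hg⟩
  obtain ⟨z, l, e⟩ := List.exists_cons_of_ne_nil (List.ne_nil_of_mem hy)
  have hz : z ∈ (Finset.univ.filter fun y => K.NonTree v y ∧ K.Good v y).toList := by simp [e]
  exact ⟨z, l ++ _, by rw [N, e]; rfl, by simpa using hz⟩

theorem nonTree_closed {v y : V} (hv : v ∈ K.C) : K.NonTree v y ↔ S.InnerLeaf y ∧ K.s y = v := by
  constructor
  · rintro ⟨hvy, ⟨h1, h2, h3⟩ | ⟨h1, h2⟩⟩
    · rcases K.closed_mem v hv y h1 hvy with h | h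
      · exact absurd h h2
      · exact absurd h h3
    · rcases S.leaf_cases h1 with hi | hi | hi
      · exact absurd (Skeleton.eq_of_degree_eq_one hi (K.φ_adj y h1) hvy.symm) h2
      · exact absurd (K.closed_outer v hv y hi hvy) h2
      · exact ⟨hi, (K.closed_inner v hv y hi hvy).resolve_left h2⟩
  · rintro ⟨hi, rfl⟩
    exact ⟨(K.s_adj y hi.1 hi.2.1).symm, Or.inr ⟨hi.1, (K.s_ne y hi.1 hi.2.1).symm⟩⟩

theorem length_N {v : V} (hv : v ∈ K.C) : (K.N v).length = K.outdeg v := by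
  rw [← List.toFinset_card_of_nodup (K.nodup_N v), outdeg]
  congr 1
  ext y
  rw [List.mem_toFinset, mem_N, K.nonTree_closed hv]
  simp

theorem length_innerChildren (v : V) : (K.innerChildren v).length = K.indeg v := by
  rw [innerChildren, Finset.length_toList, indeg]

theorem nil_of_degree_eq_two {v : V} (hv : v ∈ S.I) (hd : G.degree v = 2) :
    K.innerChildren v = [] ∧ K.N v = [] ∧ (K.B v).length ≤ 1 := by
  have h1 := K.length_ord v
  have h2 := List.length_pos_of_ne_nil (K.A_append_outerChildren_ne_nil hv)
  rw [hd, K.ord_of_mem hv, B] at h1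
  rw [B]
  simp only [List.length_cons, List.length_append] at h1 h2 ⊢
  exact ⟨List.length_eq_zero_iff.1 (by omega), List.length_eq_zero_iff.1 (by omega), by omega⟩

theorem goodEnd {v : V} (hv : v ∈ S.I) : GoodEnd K.ord G v (K.B v) (K.N v) (K.cost v) := by
  refine ⟨fun x t h => ?_, fun x m y h => ⟨?_, fun z hz => ?_⟩, ?_⟩
  · obtain ⟨h1, h2, h3⟩ := K.mem_B.1 (h ▸ List.mem_cons_self : x ∈ K.B v)
    have h4 := K.portOf_leaf_par h1 h2
    have hf : K.Flagged x := Or.inl (by rw [h3, h]; rfl)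
    rwa [h3, if_pos hf] at h4
  · obtain ⟨h1, h2, h3⟩ := K.mem_B.1 (h ▸ by simp : y ∈ K.B v)
    have h4 := K.portOf_leaf_par h1 h2
    have hf : K.Flagged y := Or.inr (by rw [h3, h, ← List.cons_append, List.getLast?_concat])
    rwa [h3, if_pos hf] at h4
  · obtain ⟨h1, h2, h3⟩ := K.mem_B.1 (h ▸ by simp [hz] : z ∈ K.B v)
    have h4 := K.portOf_leaf_par h1 h2
    have h5 := K.nodup_B v
    rw [h, List.nodup_cons, List.nodup_append] at h5
    rwa [h3, if_neg] at h4
    rintro (h6 | h6)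
    · rw [h3, h, List.head?_cons, Option.some.injEq] at h6
      exact h5.1 (by simp [h6, hz])
    · rw [h3, h, ← List.cons_append, List.getLast?_append] at h6
      simp only [List.getLast?_singleton, Option.some_or, Option.some.injEq] at h6
      exact h5.2.2.2 z hz y (by simp) h6.symm
  · by_cases hd : G.degree v = 2
    · obtain ⟨-, h1, h2⟩ := K.nil_of_degree_eq_two hv hd
      rcases Nat.le_one_iff_eq_zero_or_eq_one.1 h2 with h3 | h3
      · exact Or.inr (Or.inr (Or.inr (Or.inl ⟨List.length_eq_zero_iff.1 h3, h1⟩)))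
      · exact Or.inr (Or.inr (Or.inl ⟨h3, by simp [h1]⟩))
    by_cases hc : v ∈ K.C
    · have hcost : (K.cost v : ℤ) = 1 - ((K.indeg v : ℤ) - K.outdeg v) := by
        rw [cost, if_neg (by tauto), if_pos hc]
        have := abs_le.1 (K.balanced v hc)
        unfold indeg outdeg
        omega
      have hN := K.length_N hc
      have hI := K.length_innerChildren v
      have hB : (K.B v).length = (K.outerChildren v).length + (K.innerChildren v).length := by
        simp [B]
      rcases Nat.lt_trichotomy (K.B v).length 1 with h1 | h1 | h1
      · have h2 : K.B v = [] := List.length_eq_zero_iff.1 (by omega)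
        have hb := abs_le.1 (K.balanced v hc)
        change -1 ≤ (K.indeg v : ℤ) - K.outdeg v ∧ (K.indeg v : ℤ) - K.outdeg v ≤ 1 at hb
        rcases Nat.eq_zero_or_pos (K.N v).length with h3 | h3
        · exact Or.inr (Or.inr (Or.inr (Or.inl ⟨h2, List.length_eq_zero_iff.1 h3⟩)))
        · obtain ⟨y, hy⟩ := List.length_eq_one_iff.1 (show (K.N v).length = 1 by omega)
          refine Or.inr (Or.inr (Or.inr (Or.inr ⟨h2, y, hy, by omega, ?_⟩)))
          obtain ⟨hi, rfl⟩ := (K.nonTree_closed hc).1 (K.mem_N.1 (hy ▸ List.mem_singleton_self y))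
          have h4 := K.portOf_leaf_par hi.1 hi.2.1
          have h5 := K.portOf_leaf_s hi.1 hi.2.1
          by_cases hf : K.Flagged y
          · rw [if_pos hf] at h4 h5
            exact Or.inr ⟨h5, _, K.φ_adj y hi.1, h4, K.three_le_portOf_innerChild hi⟩
          · rw [if_neg hf] at h5
            exact Or.inl h5
      · exact Or.inr (Or.inr (Or.inl ⟨h1, by omega⟩))
      · exact Or.inl h1
    · obtain ⟨y, hvy, hy⟩ := K.not_closed v hv hc
      obtain ⟨z, l, hz, hz1, hz2⟩ := K.exists_good (v := v) (y := y)
        ⟨hvy, hy.imp id fun h => ⟨h.1, h.2.1⟩⟩ (hy.imp (fun h => h.1) fun h => h.2.2)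
      refine Or.inr (Or.inl ⟨z, l, hz, K.three_le_portOf_good hv hz1 hz2, ?_⟩)
      rw [cost, if_neg (by tauto), if_neg hc]

/-- The layout given by a choice of parents. -/
noncomputable def layout : Layout G where
  I := S.I
  ord := K.ord
  par := K.par
  rk := K.rk
  r := S.r
  r' := S.r'
  A := K.A
  B := K.B
  N := K.N
  cost := K.cost
  nodup := K.nodup_ord
  mem_ord := K.mem_ord
  ord_eq v hv := by rw [K.ord_of_mem hv, par, if_pos hv]
  ne_nil _ hv := K.ne_nil hv
  mem_child _ hv := K.mem_child hv
  rk_par := K.rk_par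
  root := K.root
  root_ne := S.adj.ne
  par_r := by rw [par, if_pos S.r_mem, S.par_r]
  par_r' := by rw [par, if_pos S.r'_mem, S.par_r']
  rk_r := by rw [rk, if_pos S.r_mem, S.rk_r]
  rk_r' := by rw [rk, if_pos S.r'_mem, S.rk_r']
  r_mem := S.r_mem
  r'_mem := S.r'_mem
  A_mem v hv y hy := by
    rcases K.mem_A.1 hy with h | ⟨h1, h2, h3⟩
    · exact Or.inl h.1
    · exact Or.inr ⟨h1, by rw [K.ord_of_notMem h1, leafOrd, if_pos h2, h3]⟩
  B_mem _ _ _ hy := (K.mem_B.1 hy).1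
  cost_eq v hv := by rw [cost, if_pos (Or.inl hv)]
  goodEnd _ hv := K.goodEnd hv

theorem cost_eq {v : V} (hv : v ∈ S.I) : (K.cost v : ℤ) = 1 - (if G.degree v = 2 then 1 else 0) -
    if v ∈ K.C then (K.indeg v : ℤ) - K.outdeg v else 0 := by
  rw [cost]
  by_cases hd : G.degree v = 2
  · rw [if_pos (Or.inr hd), if_pos hd]
    by_cases hc : v ∈ K.C
    · obtain ⟨h1, h2, -⟩ := K.nil_of_degree_eq_two hv hd
      simp [hc, ← K.length_N hc, ← K.length_innerChildren, h1, h2]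
    · simp [hc]
  · rw [if_neg (by tauto), if_neg hd]
    by_cases hc : v ∈ K.C
    · rw [if_pos hc, if_pos hc]
      have := abs_le.1 (K.balanced v hc)
      unfold indeg outdeg
      omega
    · simp [hc]

theorem sum_cost_le : ∑ v, K.cost v + (degTwo G S.I).card ≤ S.I.card := by
  have h1 : ∑ v, K.cost v = ∑ v ∈ S.I, K.cost v := by
    refine (Finset.sum_subset (Finset.subset_univ _) fun v _ hv => ?_).symm
    rw [cost, if_pos (Or.inl hv)]
  have h2 : (∑ v ∈ S.I, (K.cost v : ℤ)) = S.I.card - (degTwo G S.I).card -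
      ∑ v ∈ K.C, ((K.indeg v : ℤ) - K.outdeg v) := by
    rw [Finset.sum_congr rfl fun v hv => K.cost_eq hv, Finset.sum_sub_distrib,
      Finset.sum_sub_distrib, Finset.sum_boole, Finset.sum_ite_mem,
      Finset.inter_eq_right.2 K.C_sub]
    simp [degTwo]
  have h3 : 0 ≤ ∑ v ∈ K.C, ((K.indeg v : ℤ) - K.outdeg v) := K.total
  rw [h1]
  zify
  omega

theorem weight_layout_le : 2 * K.layout.weight Finset.univ ≤ 7 * Fintype.card V - 1 := by
  have h1 : K.layout.weight Finset.univ = 2 * Fintype.card V + 2 * ∑ v, K.cost v := by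
    rw [Layout.weight, Finset.sum_add_distrib, ← Finset.mul_sum]
    simp [layout, mul_comm]
  have h2 := K.sum_cost_le
  have h3 := S.count
  have h4 := Finset.card_sdiff_add_card_eq_card (Finset.subset_univ S.I)
  rw [Finset.card_univ] at h4
  omega

end LeafChoice

section Star

variable {V : Type*} [DecidableEq V] {G : SimpleGraph V} {ord : V → List V}

/-- From a vertex `r`, the agent visits the first `j` neighbors of `r` and returns to `r` in between
and at the end. -/
theorem run_hub (hn : ∀ v, (ord v).Nodup) (hm : ∀ v w, w ∈ ord v ↔ G.Adj v w) (r : V) (j : ℕ)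
    (hj : j ≤ (ord r).length) :
    Run G (portOf ord) (hub, r, 0) (hub, r, j) (2 * j) {y | y ∈ (ord r).take j} := by
  induction j with
  | zero => exact (Run.refl _).mono (by simp)
  | succ j ih =>
    have hp := isPortNumbering_portOf hn hm
    have hd := portDeg_eq_length (hn r) (hm r)
    set y := (ord r)[j] with hy
    have hry : G.Adj r y := (hm r y).1 (List.getElem_mem _)
    have hport : portOf ord r y = j + 1 := by rw [portOf, hy, (hn r).idxOf_getElem]
    have hback := (hp y).mapsTo hry.symm
    have hmod : j % portDeg G r = j := Nat.mod_eq_of_lt (by omega)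
    have h1 : AgentStep G (portOf ord) agent (hub, r, j) (spoke, y, portOf ord y r) := by
      refine ⟨?_, ?_, hry, ?_, rfl, rfl⟩
      · simp [agent]
      · simp only [agent, hmod]; omega
      · simp only [agent, hmod, hport]
    have h2 : AgentStep G (portOf ord) agent (spoke, y, portOf ord y r) (hub, r, j + 1) :=
      ⟨hback.1, hback.2, hry.symm, rfl, rfl, hport.symm⟩
    have h3 := (ih (by omega)).trans ((Run.single h1).trans (Run.single h2))
    refine h3.mono fun z hz => ?_
    rw [Set.mem_ofPred_eq, List.take_add_one, List.mem_append] at hz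
    rcases hz with hz | hz
    · exact Or.inl hz
    · refine Or.inr (Or.inr ?_)
      rw [List.getElem?_eq_getElem (by omega)] at hz
      simpa [hy] using hz

/-- A graph with a dominating vertex is traversed by visiting the neighbors of that vertex. -/
theorem exists_run_hub (hn : ∀ v, (ord v).Nodup) (hm : ∀ v w, w ∈ ord v ↔ G.Adj v w) (r : V)
    (hr : ∀ x, x ≠ r → G.Adj r x) (h : 0 < portDeg G r) :
    Run G (portOf ord) (hub, r, portDeg G r) (hub, r, portDeg G r) (2 * portDeg G r)
      Set.univ := by
  have hd := portDeg_eq_length (hn r) (hm r)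
  obtain ⟨t, t0, tk, ts, tv⟩ := (run_hub hn hm r (portDeg G r) hd.le).congr_start
    (s' := hub) (i' := portDeg G r) (by omega) (by simp [agent])
  refine ⟨t, t0, tk, ts, fun v _ => ?_⟩
  by_cases hv : v = r
  · exact ⟨0, by omega, by rw [t0, hv]⟩
  · refine tv v ?_
    rw [Set.mem_ofPred_eq, hd, List.take_length]
    exact (hm r v).2 (hr v hv)

end Star

/-- Every connected graph with at least two vertices has a short closed run through all vertices. -/
theorem exists_run {V : Type*} [DecidableEq V] [Fintype V] {G : SimpleGraph V}
    (hG : G.Connected) (hn : 2 ≤ Fintype.card V) :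
    ∃ ord : V → List V, (∀ v, (ord v).Nodup) ∧ (∀ v w, w ∈ ord v ↔ G.Adj v w) ∧
      ∃ (c : AgentState × V × ℕ) (k : ℕ), 1 ≤ k ∧ 2 * k ≤ 7 * Fintype.card V - 4 ∧
        1 ≤ c.2.2 ∧ c.2.2 ≤ portDeg G c.2.1 ∧ Run G (portOf ord) c c k Set.univ := by
  classical
  rcases exists_skeleton hG hn with ⟨r, hr⟩ | ⟨⟨S⟩⟩
  · have hnd : ∀ v, (G.neighborFinset v).toList.Nodup := fun v => Finset.nodup_toList _
    have hm : ∀ v w, w ∈ (G.neighborFinset v).toList ↔ G.Adj v w := by simp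
    have hd : portDeg G r + 1 = Fintype.card V := by
      rw [portDeg_eq_length (ord := fun v => (G.neighborFinset v).toList) (hnd r) (hm r),
        Finset.length_toList]
      have : G.neighborFinset r = Finset.univ.erase r := by
        ext x
        simpa using ⟨fun h => h.ne', hr x⟩
      rw [this, Finset.card_erase_add_one (Finset.mem_univ r), Finset.card_univ]
    exact ⟨fun v => (G.neighborFinset v).toList, hnd, hm, _, _, by omega, by omega,
      show 1 ≤ portDeg G r by omega, le_refl _, exists_run_hub hnd hm r hr (by omega)⟩
  · obtain ⟨K⟩ := S.exists_leafChoice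
    obtain ⟨k, hk, hrun, hk0⟩ := K.layout.exists_run
    have hw := K.weight_layout_le
    have hd := portDeg_eq_length (K.layout.nodup K.layout.r) (K.layout.mem_ord K.layout.r)
    rw [K.layout.ord_eq _ K.layout.r_mem, List.length_cons] at hd
    exact ⟨K.layout.ord, K.layout.nodup, K.layout.mem_ord, _, k, hk0, by omega, le_refl _,
      show 1 ≤ portDeg G K.layout.r by omega, hrun⟩

end PeriodicTraversal

/-- There is a constant-memory Mealy agent (finite state set `Q`, transition function `f`)
such that every finite connected graph on `n ≥ 2` vertices admits a port numbering, an
initial configuration with a valid entry port, and `L ≥ 1` with `2L ≤ 7n − 4`, such that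
the trajectory is well defined, returns to the initial configuration after `L` steps, and
visits every vertex among the first `L` configurations. -/
theorem constant_memory_periodic_traversal :
    ∃ (Q : Type) (_ : Fintype Q) (f : Q × ℕ × ℕ → Q × ℕ),
      ∀ (V : Type) [Fintype V] (G : SimpleGraph V), G.Connected → 2 ≤ Fintype.card V →
        ∃ π : V → V → ℕ, IsPortNumbering G π ∧
          ∃ (c : ℕ → Q × V × ℕ) (L : ℕ), 1 ≤ L ∧ 2 * L ≤ 7 * Fintype.card V - 4 ∧
            1 ≤ (c 0).2.2 ∧ (c 0).2.2 ≤ portDeg G (c 0).2.1 ∧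
            (∀ t : ℕ, AgentStep G π f (c t) (c (t + 1))) ∧
            c L = c 0 ∧
            ∀ v : V, ∃ t < L, (c t).2.1 = v := by
  refine ⟨PeriodicTraversal.AgentState, inferInstance, PeriodicTraversal.agent,
    fun V _ G hG hn => ?_⟩
  classical
  obtain ⟨ord, hnd, hm, c, k, hk, hk', hc, hc', hrun⟩ := PeriodicTraversal.exists_run hG hn
  obtain ⟨t, t0, tk, ts, tv⟩ := hrun.exists_periodic hk
  exact ⟨PeriodicTraversal.portOf ord, PeriodicTraversal.isPortNumbering_portOf hnd hm, t, k, hk,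
    hk', by rwa [t0], by rwa [t0], ts, by rw [t0, tk], fun v => tv v trivial⟩
end
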